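/- arXiv:1902.09616 — 2 statements merged into one kernel-verified Lean document; each statement's English description precedes it below -/
import Mathlib

section
/- (Hardy–Littlewood maximal theorem) Let 1 < p < ∞ and let f ∈ H^p, i.e., f is holomorphic on 𝔻 with sup_{0≤r<1} ∫₀^{2π} |f(re^{iθ})|^p dθ/2π < ∞. Let Mf(θ) = sup_{0≤r<1} |f(re^{iθ})|. Then Mf ∈ L^p(𝕋), and there is a constant C_p depending only on p such that ∫₀^{2π} (Mf(θ))^p dθ/2π ≤ C_p ∫₀^{2π} |f*(e^{iθ})|^p dθ/2π, where f*(e^{iθ}) = lim_{r→1⁻} f(re^{iθ}) is the radial boundary function of f, which exists almost everywhere. -/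
open MeasureTheory Filter Set
open scoped ENNReal Topology Real NNReal

noncomputable section

/-- The open unit disk in the complex plane. -/
def unitDisk : Set ℂ := Metric.ball 0 1

/-- The point `r·e^{iθ}`. -/
def circlePt (r θ : ℝ) : ℂ := (r : ℂ) * Complex.exp (θ * Complex.I)

/-- The maximal radial function `Mf(θ) = sup_{0 ≤ r < 1} |f(r e^{iθ})|`, valued in `ℝ≥0∞`. -/
def maxRad (f : ℂ → ℂ) (θ : ℝ) : ℝ≥0∞ :=
  ⨆ r ∈ Set.Ico (0 : ℝ) 1, (‖f (circlePt r θ)‖₊ : ℝ≥0∞)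

/-- `log⁺` on `ℝ≥0∞`. -/
def elogPlus (x : ℝ≥0∞) : ℝ≥0∞ :=
  if x = ∞ then ∞ else ENNReal.ofReal (Real.log x.toReal)

/-- `x ↦ log (1 + x)` on `ℝ≥0∞`. -/
def elog1p (x : ℝ≥0∞) : ℝ≥0∞ :=
  if x = ∞ then ∞ else ENNReal.ofReal (Real.log (1 + x.toReal))

/-- The radial boundary value `f*(e^{iθ}) = lim_{r→1⁻} f(r e^{iθ})`
(a junk value is returned where the limit does not exist). -/
def radialLimit (f : ℂ → ℂ) (θ : ℝ) : ℂ :=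
  limUnder (nhdsWithin (1 : ℝ) (Set.Iio 1)) fun r : ℝ => f (circlePt r θ)

/-- The class `M^p`: holomorphic functions on the unit disk with
`∫₀^{2π} (log⁺ Mf(θ))^p dθ/2π < ∞`. -/
def MpClass (p : ℝ) : Set (ℂ → ℂ) :=
  {f | DifferentiableOn ℂ f unitDisk ∧
    (∫⁻ θ in Set.Ioc 0 (2 * π), elogPlus (maxRad f θ) ^ p) / ENNReal.ofReal (2 * π) < ∞}

/-- The metric `ρ_p` on `M^p`. -/
def rhoMetric (p : ℝ) (f g : ℂ → ℂ) : ℝ≥0∞ :=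
  ((∫⁻ θ in Set.Ioc 0 (2 * π), elog1p (maxRad (f - g) θ) ^ p) /
    ENNReal.ofReal (2 * π)) ^ (1 / p)

/-- The Privalov class `N^p`: holomorphic functions on the unit disk with
`sup_{0≤r<1} ∫₀^{2π} (log⁺|f(re^{iθ})|)^p dθ/2π < ∞`. -/
def NpClass (p : ℝ) : Set (ℂ → ℂ) :=
  {f | DifferentiableOn ℂ f unitDisk ∧
    (⨆ r ∈ Set.Ico (0 : ℝ) 1,
      (∫⁻ θ in Set.Ioc 0 (2 * π),
        ENNReal.ofReal (Real.log ‖f (circlePt r θ)‖) ^ p) / ENNReal.ofReal (2 * π)) < ∞}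

/-- The metric `d_p` on `N^p`, defined via boundary values. -/
def dMetric (p : ℝ) (f g : ℂ → ℂ) : ℝ≥0∞ :=
  ((∫⁻ θ in Set.Ioc 0 (2 * π),
      ENNReal.ofReal (Real.log (1 + ‖radialLimit f θ - radialLimit g θ‖)) ^ p) /
    ENNReal.ofReal (2 * π)) ^ (1 / p)

/-- The Hardy space `H^p`. -/
def HpClass (p : ℝ) : Set (ℂ → ℂ) :=
  {f | DifferentiableOn ℂ f unitDisk ∧
    (⨆ r ∈ Set.Ico (0 : ℝ) 1,
      (∫⁻ θ in Set.Ioc 0 (2 * π), (‖f (circlePt r θ)‖₊ : ℝ≥0∞) ^ p) /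
        ENNReal.ofReal (2 * π)) < ∞}

/-- The Smirnov class `N⁺`. -/
def SmirnovClass : Set (ℂ → ℂ) :=
  {f | DifferentiableOn ℂ f unitDisk ∧
    (∫⁻ θ in Set.Ioc 0 (2 * π), ENNReal.ofReal (Real.log ‖radialLimit f θ‖)) /
      ENNReal.ofReal (2 * π) < ∞ ∧
    Tendsto
      (fun r : ℝ => (∫⁻ θ in Set.Ioc 0 (2 * π),
        ENNReal.ofReal (Real.log ‖f (circlePt r θ)‖)) / ENNReal.ofReal (2 * π))
      (nhdsWithin (1 : ℝ) (Set.Iio 1))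
      (nhds ((∫⁻ θ in Set.Ioc 0 (2 * π),
        ENNReal.ofReal (Real.log ‖radialLimit f θ‖)) / ENNReal.ofReal (2 * π)))}

/-- The normalized Blaschke factor `(|a|/a)·(a − z)/(1 − conj a · z)`. -/
def blaschkeFactor (a z : ℂ) : ℂ :=
  ((‖a‖ : ℂ) / a) * ((a - z) / (1 - (starRingEnd ℂ) a * z))

/-- `B` is a (finite or infinite) Blaschke product on the unit disk. -/
def IsBlaschkeProduct (B : ℂ → ℂ) : Prop :=
  ∃ m : ℕ,
    (∃ n : ℕ, ∃ a : ℕ → ℂ, (∀ k < n, a k ∈ unitDisk ∧ a k ≠ 0) ∧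
      ∀ z ∈ unitDisk, B z = z ^ m * ∏ k ∈ Finset.range n, blaschkeFactor (a k) z) ∨
    (∃ a : ℕ → ℂ, (∀ k, a k ∈ unitDisk ∧ a k ≠ 0) ∧ (Summable fun k => 1 - ‖a k‖) ∧
      ∀ z ∈ unitDisk, B z = z ^ m * ∏' k, blaschkeFactor (a k) z)

/-- `I` is an ideal of the ring `M^p`. -/
structure IsIdealIn (p : ℝ) (I : Set (ℂ → ℂ)) : Prop where
  subset : I ⊆ MpClass p
  zero_mem : (0 : ℂ → ℂ) ∈ I
  add_mem : ∀ f ∈ I, ∀ g ∈ I, f + g ∈ I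
  neg_mem : ∀ f ∈ I, -f ∈ I
  mul_mem : ∀ f ∈ MpClass p, ∀ g ∈ I, f * g ∈ I

/-- `I` is a prime ideal of the ring `M^p`: an ideal such that whenever a product of two
elements of `M^p` lies in `I`, one of the factors lies in `I`. -/
def IsPrimeIdealIn (p : ℝ) (I : Set (ℂ → ℂ)) : Prop :=
  IsIdealIn p I ∧ ∀ f ∈ MpClass p, ∀ g ∈ MpClass p, f * g ∈ I → f ∈ I ∨ g ∈ I

/-- `I` is a dense subset of the metric space `(M^p, ρ_p)`. -/
def IsDenseIn (p : ℝ) (I : Set (ℂ → ℂ)) : Prop :=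
  ∀ f ∈ MpClass p, ∀ ε : ℝ≥0∞, 0 < ε → ∃ g ∈ I, rhoMetric p f g < ε

/-- `I` is an ideal of the ring `N^p`. -/
structure IsIdealInNp (p : ℝ) (I : Set (ℂ → ℂ)) : Prop where
  subset : I ⊆ NpClass p
  zero_mem : (0 : ℂ → ℂ) ∈ I
  add_mem : ∀ f ∈ I, ∀ g ∈ I, f + g ∈ I
  neg_mem : ∀ f ∈ I, -f ∈ I
  mul_mem : ∀ f ∈ NpClass p, ∀ g ∈ I, f * g ∈ I

/-- `I` is a prime ideal of the ring `N^p`. -/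
def IsPrimeIdealInNp (p : ℝ) (I : Set (ℂ → ℂ)) : Prop :=
  IsIdealInNp p I ∧ ∀ f ∈ NpClass p, ∀ g ∈ NpClass p, f * g ∈ I → f ∈ I ∨ g ∈ I

/-- `I` is a dense subset of the metric space `(N^p, d_p)`. -/
def IsDenseInNp (p : ℝ) (I : Set (ℂ → ℂ)) : Prop :=
  ∀ f ∈ NpClass p, ∀ ε : ℝ≥0∞, 0 < ε → ∃ g ∈ I, dMetric p f g < ε



/-- weak type covering estimate -/
lemma weak_type_cover (u : ℝ → ℝ≥0∞) (hu : ∫⁻ t, u t ≠ ∞) (l : ℝ) (hl : 0 < l)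
    (E : Set ℝ)
    (hE : ∀ x ∈ E, ∃ s > 0, ENNReal.ofReal (l * (2 * s)) ≤ ∫⁻ t in Metric.closedBall x s, u t) :
    ENNReal.ofReal l * volume E ≤ 5 * ∫⁻ t, u t := by
  choose! s hs0 hs using hE
  have hbd : ∀ x ∈ E, s x ≤ (∫⁻ t, u t).toReal / (2 * l) := by
    intro x hx
    have h1 : ENNReal.ofReal (l * (2 * s x)) ≤ ∫⁻ t, u t :=
      (hs x hx).trans (setLIntegral_le_lintegral _ _)
    have h2 := (ENNReal.ofReal_le_iff_le_toReal hu).1 h1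
    rw [le_div_iff₀ (by positivity)]
    linarith
  obtain ⟨v, hvE, hdisj, hcov⟩ := Vitali.exists_disjoint_subfamily_covering_enlargement_closedBall
    E (fun x => x) s _ hbd 5 (by norm_num)
  have hcount : v.Countable := by
    refine hdisj.countable_of_nonempty_interior ?_
    intro x hx
    refine ⟨x, ?_⟩
    exact Metric.ball_subset_interior_closedBall (Metric.mem_ball_self (hs0 x (hvE hx)))
  have hsub : E ⊆ ⋃ x ∈ v, Metric.closedBall x (5 * s x) := by
    intro x hx
    obtain ⟨b, hb, hb2⟩ := hcov x hx
    exact mem_biUnion hb (hb2 (Metric.mem_closedBall_self (hs0 x hx).le))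
  have := hcount.to_subtype
  calc ENNReal.ofReal l * volume E
      ≤ ENNReal.ofReal l * ∑' x : v, volume (Metric.closedBall (x : ℝ) (5 * s x)) := by
        gcongr
        exact (measure_mono hsub).trans (measure_biUnion_le _ hcount _)
    _ = ∑' x : v, 5 * ENNReal.ofReal (l * (2 * s x)) := by
        rw [← ENNReal.tsum_mul_left]
        congr 1; ext x
        have := hs0 x (hvE x.2)
        rw [Real.volume_closedBall, ← ENNReal.ofReal_mul hl.le,
          show (5 : ℝ≥0∞) = ENNReal.ofReal 5 by simp, ← ENNReal.ofReal_mul (by norm_num)]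
        congr 1; ring
    _ ≤ ∑' x : v, 5 * ∫⁻ t in Metric.closedBall (x : ℝ) (s x), u t := by
        gcongr with x
        exact hs x (hvE x.2)
    _ = 5 * ∑' x : v, ∫⁻ t in Metric.closedBall (x : ℝ) (s x), u t := ENNReal.tsum_mul_left
    _ = 5 * ∫⁻ t in ⋃ x ∈ v, Metric.closedBall (x : ℝ) (s x), u t := by
        rw [lintegral_biUnion hcount (fun _ _ => Metric.isClosed_closedBall.measurableSet) hdisj]
    _ ≤ 5 * ∫⁻ t, u t := by
        exact mul_le_mul_right (setLIntegral_le_lintegral _ _) _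

/-- power integral -/
lemma lint_pow (q b : ℝ) (hq : -1 < q) (hb : 0 ≤ b) :
    ∫⁻ l in Ioo 0 b, ENNReal.ofReal (l ^ q) = ENNReal.ofReal (b ^ (q + 1) / (q + 1)) := by
  rw [← ofReal_integral_eq_lintegral_ofReal]
  · rw [← integral_Ioc_eq_integral_Ioo, ← intervalIntegral.integral_of_le hb,
      integral_rpow (Or.inl hq), Real.zero_rpow (by linarith), sub_zero]
  · have := (intervalIntegral.intervalIntegrable_rpow' hq (a := 0) (b := b))
    rw [intervalIntegrable_iff_integrableOn_Ioo_of_le hb] at this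
    exact this
  · refine (ae_restrict_iff' measurableSet_Ioo).2 (ae_of_all _ fun x hx => ?_)
    exact Real.rpow_nonneg hx.1.le _

/-- Marcinkiewicz type interpolation -/
lemma marcin (p : ℝ) (hp : 1 < p) (μ : Measure ℝ) (N : ℝ → ℝ) (hN : Measurable N)
    (hN0 : ∀ x, 0 ≤ N x) (u : ℝ → ℝ) (hu : Measurable u) (hu0 : ∀ x, 0 ≤ u x) (A : ℝ≥0∞)
    (c : ℝ) (hc : 0 < c)
    (h : ∀ l : ℝ, 0 < l → ENNReal.ofReal l * μ {x | l < N x} ≤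
      A * ∫⁻ t in {t | c * l < u t}, ENNReal.ofReal (u t)) :
    ∫⁻ x, ENNReal.ofReal (N x ^ p) ∂μ ≤
      (ENNReal.ofReal p * A * ENNReal.ofReal (c⁻¹ ^ (p - 1) / (p - 1))) *
        ∫⁻ t, ENNReal.ofReal (u t ^ p) := by
  rw [lintegral_rpow_eq_lintegral_meas_lt_mul μ (ae_of_all _ hN0) hN.aemeasurable (by linarith),
    mul_assoc, mul_assoc]
  gcongr
  have key : ∀ l ∈ Ioi (0:ℝ), μ {x | l < N x} * ENNReal.ofReal (l ^ (p - 1)) ≤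
      A * ∫⁻ t, (ENNReal.ofReal (u t) * ENNReal.ofReal (l ^ (p - 2))) *
        ({q : ℝ × ℝ | c * q.1 < u q.2}.indicator (fun _ => 1) (l, t)) := by
    intro l hl
    have hl : 0 < l := hl
    have e : l ^ (p - 1) = l * l ^ (p - 2) := by
      rw [show p - 1 = 1 + (p - 2) by ring, Real.rpow_add hl, Real.rpow_one]
    rw [e, ENNReal.ofReal_mul hl.le, ← mul_assoc, mul_comm (μ _)]
    refine (mul_le_mul_left (h l hl) _).trans ?_
    rw [mul_assoc]
    gcongr
    rw [← lintegral_mul_const _ (by fun_prop), ← lintegral_indicator (measurableSet_lt (by fun_prop) hu)]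
    refine lintegral_mono fun t => ?_
    by_cases ht : c * l < u t <;> simp [indicator, ht]
  have hms : MeasurableSet {q : ℝ × ℝ | c * q.1 < u q.2} :=
    measurableSet_lt (by fun_prop) (hu.comp measurable_snd)
  have hmeas : Measurable (fun q : ℝ × ℝ => (ENNReal.ofReal (u q.2) * ENNReal.ofReal (q.1 ^ (p - 2))) *
        ({q : ℝ × ℝ | c * q.1 < u q.2}.indicator (fun _ => (1:ℝ≥0∞)) (q.1, q.2))) := by
    refine Measurable.mul (by fun_prop) ?_
    exact (measurable_const.indicator hms)
  refine (setLIntegral_mono' measurableSet_Ioi key).trans ?_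
  rw [lintegral_const_mul _ hmeas.lintegral_prod_right']
  gcongr
  rw [lintegral_lintegral_swap hmeas.aemeasurable, ← lintegral_const_mul _ (by fun_prop)]
  refine lintegral_mono fun t => ?_
  have : ∀ l ∈ Ioi (0:ℝ), (ENNReal.ofReal (u t) * ENNReal.ofReal (l ^ (p - 2))) *
        ({q : ℝ × ℝ | c * q.1 < u q.2}.indicator (fun _ => (1:ℝ≥0∞)) (l, t)) ≤
        (Ioo 0 (u t / c)).indicator (fun l => ENNReal.ofReal (u t) * ENNReal.ofReal (l ^ (p - 2))) l := by
    intro l hl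
    have hl : 0 < l := hl
    by_cases ht : c * l < u t
    · have : l ∈ Ioo 0 (u t / c) := ⟨hl, by rw [lt_div_iff₀ hc]; linarith⟩
      simp [indicator, ht, this]
    · simp [indicator, ht]
  refine (setLIntegral_mono' measurableSet_Ioi this).trans ?_
  refine (setLIntegral_le_lintegral _ _).trans ?_
  rw [lintegral_indicator measurableSet_Ioo, lintegral_const_mul _ (by fun_prop),
    lint_pow _ _ (by linarith) (div_nonneg (hu0 t) hc.le), ← ENNReal.ofReal_mul (hu0 t),
    ← ENNReal.ofReal_mul (by have : 0 < p - 1 := by linarith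
                             positivity)]
  refine ENNReal.ofReal_le_ofReal (le_of_eq ?_)
  rw [show p - 2 + 1 = p - 1 by ring, div_eq_mul_inv (u t) c, Real.mul_rpow (hu0 t) (by positivity)]
  rcases (hu0 t).eq_or_lt with h0 | h0
  · rw [← h0, Real.zero_rpow (by linarith : p ≠ 0)]; ring
  · have : u t ^ p = u t * u t ^ (p - 1) := by
      rw [show p = 1 + (p - 1) by ring, Real.rpow_add h0, Real.rpow_one]; simp
    rw [this]; ring

/-- the Poisson kernel -/
def pk (r θ t : ℝ) : ℝ := (1 - r ^ 2) / ‖circlePt 1 t - circlePt r θ‖ ^ 2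

lemma continuous_circlePt (r : ℝ) : Continuous (circlePt r) := by
  unfold circlePt; fun_prop

lemma norm_circlePt (r θ : ℝ) : ‖circlePt r θ‖ = |r| := by
  simp [circlePt, Complex.norm_exp_ofReal_mul_I]

lemma circlePt_periodic (r : ℝ) : Function.Periodic (circlePt r) (2 * π) := by
  intro t
  simp only [circlePt]
  congr 1
  push_cast
  rw [add_mul, Complex.exp_add, Complex.exp_two_pi_mul_I, mul_one]

lemma dist_ge (r θ t : ℝ) (h0 : 0 ≤ r) (_h1 : r < 1) :
    1 - r ≤ ‖circlePt 1 t - circlePt r θ‖ := by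
  have := norm_sub_norm_le (circlePt 1 t) (circlePt r θ)
  rw [norm_circlePt, norm_circlePt, abs_one, abs_of_nonneg h0] at this
  exact this

lemma continuous_pk (r θ : ℝ) (h0 : 0 ≤ r) (h1 : r < 1) : Continuous (pk r θ) := by
  unfold pk
  refine Continuous.div continuous_const ?_ ?_
  · have := continuous_circlePt 1
    fun_prop
  · intro t
    have := dist_ge r θ t h0 h1
    have : 0 < ‖circlePt 1 t - circlePt r θ‖ := by linarith
    positivity

lemma pk_nonneg (r θ t : ℝ) (h0 : 0 ≤ r) (h1 : r < 1) : 0 ≤ pk r θ t := by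
  unfold pk
  have : 0 ≤ 1 - r ^ 2 := by nlinarith
  positivity

lemma pk_periodic (r θ : ℝ) : Function.Periodic (pk r θ) (2 * π) := by
  intro t
  simp only [pk, circlePt_periodic 1 t]

lemma kernel_le (r θ t a : ℝ) (h0 : 0 ≤ r) (h1 : r < 1) (ha : 0 < a)
    (h : |t - θ| ≤ a * ‖circlePt 1 t - circlePt r θ‖) :
    ENNReal.ofReal (pk r θ t) ≤ ∑' k : ℕ, ENNReal.ofReal (8 / (1 - r) / 4 ^ k) *
      (Metric.closedBall θ (a * 2 ^ k * (1 - r))).indicator (fun _ => 1) t := by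
  have hd := dist_ge r θ t h0 h1
  unfold pk
  set D := ‖circlePt 1 t - circlePt r θ‖
  have hδ : 0 < 1 - r := by linarith
  obtain ⟨n, hn1, hn2⟩ := exists_nat_pow_near (x := D / (1 - r)) (y := 2)
    (by rw [le_div_iff₀ hδ]; linarith) (by norm_num)
  rw [le_div_iff₀ hδ] at hn1
  rw [div_lt_iff₀ hδ] at hn2
  refine le_trans ?_ (ENNReal.le_tsum (n + 1))
  have hmem : t ∈ Metric.closedBall θ (a * 2 ^ (n + 1) * (1 - r)) := by
    rw [Metric.mem_closedBall, Real.dist_eq]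
    calc |t - θ| ≤ a * D := h
      _ ≤ a * (2 ^ (n + 1) * (1 - r)) := by gcongr
      _ = _ := by ring
  rw [indicator_of_mem hmem, mul_one]
  apply ENNReal.ofReal_le_ofReal
  have hDpos : 0 < D := by linarith
  rw [div_le_iff₀ (by positivity)]
  have h4 : (2 ^ n * (1 - r)) ^ 2 ≤ D ^ 2 := by gcongr
  calc 1 - r ^ 2 ≤ 2 * (1 - r) := by nlinarith
    _ = 8 / (1 - r) / 4 ^ (n + 1) * (2 ^ n * (1 - r)) ^ 2 := by
        have : (4:ℝ) ^ (n + 1) = 4 * (2 ^ n) ^ 2 := by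
          rw [pow_succ, ← pow_mul, mul_comm n 2, pow_mul]; norm_num; ring
        rw [this]; field_simp; norm_num
    _ ≤ _ := by gcongr

lemma kernel_int (r θ a : ℝ) (h0 : 0 ≤ r) (h1 : r < 1) (ha : 0 < a) (S : Set ℝ)
    (hS : MeasurableSet S) (h : ∀ t ∈ S, |t - θ| ≤ a * ‖circlePt 1 t - circlePt r θ‖)
    (u : ℝ → ℝ≥0∞) (hu : Measurable u) :
    ∫⁻ t in S, ENNReal.ofReal (pk r θ t) * u t ≤ ∑' k : ℕ, ENNReal.ofReal (8 / (1 - r) / 4 ^ k) *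
      ∫⁻ t in Metric.closedBall θ (a * 2 ^ k * (1 - r)), u t := by
  calc ∫⁻ t in S, ENNReal.ofReal (pk r θ t) * u t
      ≤ ∫⁻ t in S, ∑' k : ℕ, ENNReal.ofReal (8 / (1 - r) / 4 ^ k) *
      ((Metric.closedBall θ (a * 2 ^ k * (1 - r))).indicator u t) := by
        refine setLIntegral_mono' hS fun t ht => ?_
        refine (mul_le_mul_left (kernel_le r θ t a h0 h1 ha (h t ht)) _).trans ?_
        rw [← ENNReal.tsum_mul_right]
        refine ENNReal.tsum_le_tsum fun k => ?_
        refine (mul_assoc (ENNReal.ofReal (8 / (1 - r) / 4 ^ k)) _ _).le.trans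
          (mul_le_mul_right ?_ _)
        by_cases hh : t ∈ Metric.closedBall θ (a * 2 ^ k * (1 - r)) <;> simp only [indicator, hh]
          <;> simp
    _ ≤ ∫⁻ t, ∑' k : ℕ, ENNReal.ofReal (8 / (1 - r) / 4 ^ k) *
      ((Metric.closedBall θ (a * 2 ^ k * (1 - r))).indicator u t) := setLIntegral_le_lintegral _ _
    _ = _ := by
      have hm : ∀ k : ℕ, Measurable
          ((Metric.closedBall θ (a * 2 ^ k * (1 - r))).indicator u) := fun k =>
        hu.indicator Metric.isClosed_closedBall.measurableSet
      rw [lintegral_tsum (fun k => ((hm k).const_mul _).aemeasurable)]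
      congr 1; ext k
      rw [lintegral_const_mul _ (hm k), lintegral_indicator Metric.isClosed_closedBall.measurableSet]

lemma dist_le_aux (r θ t c : ℝ) (h0 : 0 ≤ r) (h1 : r < 1) (hc : 0 < c)
    (h : c * |t - θ| ≤ ‖circlePt 1 t - circlePt 1 θ‖) :
    |t - θ| ≤ (2 / c) * ‖circlePt 1 t - circlePt r θ‖ := by
  have hd := dist_ge r θ t h0 h1
  have h2 : ‖circlePt r θ - circlePt 1 θ‖ = 1 - r := by
    have : circlePt r θ - circlePt 1 θ = circlePt (r - 1) θ := by
      simp [circlePt]; ring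
    rw [this, norm_circlePt, abs_of_nonpos (by linarith)]; ring
  have h3 := norm_sub_le_norm_sub_add_norm_sub (circlePt 1 t) (circlePt r θ) (circlePt 1 θ)
  rw [div_mul_eq_mul_div, le_div_iff₀ hc]
  linarith

lemma chord_eq (t θ : ℝ) : ‖circlePt 1 t - circlePt 1 θ‖ = 2 * |Real.sin ((t - θ) / 2)| := by
  have : circlePt 1 t - circlePt 1 θ =
      Complex.exp (θ * Complex.I) * (Complex.exp (Complex.I * ((t - θ : ℝ) : ℂ)) - 1) := by
    simp only [circlePt]
    rw [mul_sub, ← Complex.exp_add]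
    push_cast
    ring_nf
  rw [this, norm_mul, Complex.norm_exp_ofReal_mul_I, one_mul, Complex.norm_exp_I_mul_ofReal_sub_one]
  simp

lemma chord1 (t θ : ℝ) (h : |t - θ| ≤ π) : 2 / π * |t - θ| ≤ ‖circlePt 1 t - circlePt 1 θ‖ := by
  rw [chord_eq]
  have := Real.mul_abs_le_abs_sin (x := (t - θ) / 2) (by rw [abs_div, abs_two]; linarith)
  rw [abs_div, abs_two] at this
  linarith

lemma chord2 (θ : ℝ) (h0 : 0 < θ) (h1 : θ < 2 * π) :
    ∃ c > 0, ∀ t ∈ Ioc 0 (2 * π), c * |t - θ| ≤ ‖circlePt 1 t - circlePt 1 θ‖ := by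
  have hπ := Real.pi_pos
  obtain ⟨η, hη, hη1, hη2⟩ : ∃ η > 0, η ≤ θ ∧ η ≤ 2 * π - θ :=
    ⟨min θ (2 * π - θ), by simp [h0, h1], min_le_left _ _, min_le_right _ _⟩
  refine ⟨min (2 / π) (η / π ^ 2), by positivity, fun t ht => ?_⟩
  by_cases h : |t - θ| ≤ π
  · refine le_trans ?_ (chord1 t θ h)
    gcongr
    exact min_le_left _ _
  · push Not at h
    have hub : |t - θ| ≤ 2 * π - η := by
      rw [abs_le]; constructor <;> linarith [ht.1, ht.2]
    have e : |Real.sin ((t - θ) / 2)| = Real.sin (π - |t - θ| / 2) := by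
      rw [Real.sin_pi_sub]
      rcases abs_cases (t - θ) with ⟨h3, h4⟩ | ⟨h3, h4⟩
      · rw [h3, abs_of_nonneg]
        apply Real.sin_nonneg_of_nonneg_of_le_pi <;> linarith
      · rw [h3, neg_div, Real.sin_neg, abs_of_nonpos]
        apply Real.sin_nonpos_of_nonpos_of_neg_pi_le <;> linarith
    rw [chord_eq, e]
    have h5 := Real.mul_le_sin (x := π - |t - θ| / 2) (by linarith) (by linarith)
    calc min (2 / π) (η / π ^ 2) * |t - θ| ≤ (η / π ^ 2) * (2 * π) := by
          gcongr
          · exact min_le_right _ _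
          · linarith
      _ = 2 * (2 / π * (η / 2)) := by field_simp
      _ ≤ 2 * (2 / π * (π - |t - θ| / 2)) := by gcongr; linarith
      _ ≤ _ := by gcongr

/-- Poisson formula -/
lemma poisson_formula (F : ℂ → ℂ) (hF : DiffContOnCl ℂ F (Metric.ball 0 1)) (r θ : ℝ)
    (h0 : 0 ≤ r) (h1 : r < 1) :
    ∫ t in (0:ℝ)..(2 * π), (pk r θ t : ℂ) * F (circlePt 1 t) = 2 * π * F (circlePt r θ) := by
  have hw : circlePt r θ ∈ Metric.ball (0:ℂ) 1 := by
    simp [norm_circlePt, abs_of_nonneg h0, h1]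
  have h := hF.circleAverage_poissonKernel_smul' hw
  rw [← h, Real.circleAverage_def]
  have : ∀ t : ℝ, circleMap 0 1 t = circlePt 1 t := by intro t; simp [circleMap, circlePt]
  simp only [this, sub_zero, norm_circlePt]
  simp only [pk, abs_one, sq_abs, one_pow, Complex.real_smul]
  push_cast
  have : (π : ℂ) ≠ 0 := by exact_mod_cast Real.pi_ne_zero
  field_simp

lemma poisson_one (r θ : ℝ) (h0 : 0 ≤ r) (h1 : r < 1) :
    ∫ t in (0:ℝ)..(2 * π), (pk r θ t : ℂ) = 2 * π := by
  simpa using poisson_formula (fun _ => 1) diffContOnCl_const r θ h0 h1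

lemma measurable_maxRad (f : ℂ → ℂ) (hf : ContinuousOn f unitDisk) : Measurable (maxRad f) := by
  apply LowerSemicontinuous.measurable
  apply lowerSemicontinuous_biSup
  intro r hr
  apply Continuous.lowerSemicontinuous
  have : Continuous (fun θ => f (circlePt r θ)) := by
    rw [← continuousOn_univ]
    refine hf.comp (continuous_circlePt r).continuousOn ?_
    intro θ _
    simp [unitDisk, norm_circlePt, abs_of_nonneg hr.1, hr.2]
  exact ENNReal.continuous_coe.comp this.nnnorm

lemma tsum_geo (A B δ a : ℝ) (hA : 0 ≤ A) (hδ : 0 < δ) (hB : B = 32 * a * A) (ha : 0 < a) :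
    ∑' k : ℕ, ENNReal.ofReal (8 / δ / 4 ^ k) * ENNReal.ofReal (A * (2 * (a * 2 ^ k * δ))) =
      ENNReal.ofReal B := by
  have e : ∀ k : ℕ, ENNReal.ofReal (8 / δ / 4 ^ k) * ENNReal.ofReal (A * (2 * (a * 2 ^ k * δ))) =
      ENNReal.ofReal (16 * a * A * (1 / 2) ^ k) := by
    intro k
    rw [← ENNReal.ofReal_mul (by positivity)]
    congr 1
    have : (4:ℝ) ^ k = 2 ^ k * 2 ^ k := by rw [← mul_pow]; norm_num
    rw [this, one_div, inv_pow]
    field_simp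
    ring
  simp only [e]
  have hs : HasSum (fun k : ℕ => 16 * a * A * (1 / 2) ^ k) B := by
    have := hasSum_geometric_two.mul_left (16 * a * A)
    rw [hB]
    rw [show 32 * a * A = 16 * a * A * 2 by ring]; exact this
  rw [← ENNReal.ofReal_tsum_of_nonneg (fun k => by positivity) hs.summable, hs.tsum_eq]

/-- window function -/
def wu (F : ℂ → ℂ) (t : ℝ) : ℝ := (Ioc (-π) (3 * π)).indicator (fun t => ‖F (circlePt 1 t)‖) t

lemma cont_bdry (F : ℂ → ℂ) (hc : ContinuousOn F (Metric.closedBall 0 1)) :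
    Continuous (fun t => F (circlePt 1 t)) := by
  rw [← continuousOn_univ]
  refine hc.comp (continuous_circlePt 1).continuousOn ?_
  intro θ _
  simp [norm_circlePt]

lemma wu_meas (F : ℂ → ℂ) (hc : ContinuousOn F (Metric.closedBall 0 1)) : Measurable (wu F) :=
  (cont_bdry F hc).norm.measurable.indicator measurableSet_Ioc

lemma wu_nonneg (F : ℂ → ℂ) (t : ℝ) : 0 ≤ wu F t := indicator_nonneg (fun _ _ => norm_nonneg _) _

lemma wu_bdd (F : ℂ → ℂ) (hc : ContinuousOn F (Metric.closedBall 0 1)) :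
    ∫⁻ t, ENNReal.ofReal (wu F t) ≠ ∞ := by
  have h := (cont_bdry F hc).norm.integrableOn_Ioc (a := -π) (b := 3 * π) (μ := volume)
  rw [← integrable_indicator_iff measurableSet_Ioc] at h
  exact h.lintegral_lt_top.ne

lemma ptwise (F : ℂ → ℂ) (hF : DiffContOnCl ℂ F (Metric.ball 0 1))
    (hc : ContinuousOn F (Metric.closedBall 0 1)) (r θ : ℝ)
    (h0 : 0 ≤ r) (h1 : r < 1) (hθ : θ ∈ Ioc 0 (2 * π)) :
    ENNReal.ofReal (2 * π * ‖F (circlePt r θ)‖) ≤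
      ∑' k : ℕ, ENNReal.ofReal (8 / (1 - r) / 4 ^ k) *
      ∫⁻ t in Metric.closedBall θ (π * 2 ^ k * (1 - r)), ENNReal.ofReal (wu F t) := by
  have hπ := Real.pi_pos
  refine le_trans ?_ (kernel_int r θ π h0 h1 hπ (Ioc (θ - π) (θ - π + 2 * π)) measurableSet_Ioc
    ?_ (fun t => ENNReal.ofReal (wu F t)) (wu_meas F hc).ennreal_ofReal)
  · have h := poisson_formula F hF r θ h0 h1
    have hper : Function.Periodic (fun t => (pk r θ t : ℂ) * F (circlePt 1 t)) (2 * π) := by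
      intro t
      simp only [pk_periodic r θ t, circlePt_periodic 1 t]
    have h2 := hper.intervalIntegral_add_eq 0 (θ - π)
    rw [zero_add, h, intervalIntegral.integral_of_le (by linarith)] at h2
    have h3 : 2 * π * ‖F (circlePt r θ)‖ = ‖2 * π * F (circlePt r θ)‖ := by
      simp [abs_of_pos hπ]
    rw [h3, h2, ofReal_norm]
    refine (enorm_integral_le_lintegral_enorm _).trans ?_
    refine setLIntegral_mono' measurableSet_Ioc fun t ht => ?_
    have ht' : t ∈ Ioc (-π) (3 * π) := ⟨by linarith [ht.1, hθ.1], by linarith [ht.2, hθ.2]⟩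
    rw [wu, indicator_of_mem ht', ← ENNReal.ofReal_mul (pk_nonneg r θ t h0 h1),
      ← ofReal_norm, norm_mul, Complex.norm_real, Real.norm_of_nonneg (pk_nonneg r θ t h0 h1)]
  · intro t ht
    have := dist_le_aux r θ t (2 / π) h0 h1 (by positivity) (chord1 t θ (by
      rw [abs_le]; constructor <;> linarith [ht.1, ht.2]))
    simpa using this

lemma weak_maxRad (F : ℂ → ℂ) (hF : DiffContOnCl ℂ F (Metric.ball 0 1))
    (hc : ContinuousOn F (Metric.closedBall 0 1)) (l : ℝ) (hl : 0 < l) :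
    ENNReal.ofReal l * (volume.restrict (Ioc 0 (2 * π))) {x | l < (maxRad F x).toReal} ≤
      160 * ∫⁻ t in {t | (1 / 32) * l < wu F t}, ENNReal.ofReal (wu F t) := by
  have hπ := Real.pi_pos
  have hms : MeasurableSet {t | (1 / 32) * l < wu F t} := measurableSet_lt (by fun_prop) (wu_meas F hc)
  set v : ℝ → ℝ≥0∞ := {t | (1 / 32) * l < wu F t}.indicator (fun t => ENNReal.ofReal (wu F t))
  have hv : ∫⁻ t, v t = ∫⁻ t in {t | (1 / 32) * l < wu F t}, ENNReal.ofReal (wu F t) :=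
    lintegral_indicator hms _
  have hvfin : ∫⁻ t, v t ≠ ∞ := by
    rw [hv]
    exact ((setLIntegral_le_lintegral _ _).trans_lt (wu_bdd F hc).lt_top).ne
  have hE : ∀ x ∈ {x | l < (maxRad F x).toReal} ∩ Ioc 0 (2 * π), ∃ s > 0,
      ENNReal.ofReal (l / 32 * (2 * s)) ≤ ∫⁻ t in Metric.closedBall x s, v t := by
    rintro x ⟨hx, hx2⟩
    have hx' : ENNReal.ofReal l < maxRad F x := by
      rw [ENNReal.ofReal_lt_iff_lt_toReal hl.le]
      · exact hx
      · intro h; simp [h] at hx; linarith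
    simp only [maxRad, lt_iSup_iff] at hx'
    obtain ⟨r, hr, hlr⟩ := hx'
    have hlr : l < ‖F (circlePt r x)‖ := by
      have : ENNReal.ofReal l < ENNReal.ofReal ‖F (circlePt r x)‖ := by
        rwa [ofReal_norm]
      exact (ENNReal.ofReal_lt_ofReal_iff_of_nonneg hl.le).1 this
    have hp := ptwise F hF hc r x hr.1 hr.2 hx2
    have hδ : 0 < 1 - r := by linarith [hr.2]
    by_contra! hcon
    have hk : ∀ k : ℕ, ∫⁻ t in Metric.closedBall x (π * 2 ^ k * (1 - r)), ENNReal.ofReal (wu F t) ≤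
        ENNReal.ofReal (l / 16 * (2 * (π * 2 ^ k * (1 - r)))) := by
      intro k
      set s := π * 2 ^ k * (1 - r) with hs
      have hs0 : 0 < s := by positivity
      have h1 := hcon s hs0
      calc ∫⁻ t in Metric.closedBall x s, ENNReal.ofReal (wu F t)
          ≤ ∫⁻ t in Metric.closedBall x s, (v t + ENNReal.ofReal (l / 32)) := by
            refine lintegral_mono fun t => ?_
            by_cases ht : (1 / 32) * l < wu F t
            · have : v t = ENNReal.ofReal (wu F t) := indicator_of_mem (s := {t | (1 / 32) * l < wu F t}) ht _
              rw [this]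
              exact le_self_add
            · refine le_trans ?_ le_add_self
              apply ENNReal.ofReal_le_ofReal
              linarith
        _ = (∫⁻ t in Metric.closedBall x s, v t) + ENNReal.ofReal (l / 32) * ENNReal.ofReal (2 * s) := by
            rw [lintegral_add_right _ measurable_const, setLIntegral_const, Real.volume_closedBall]
        _ ≤ ENNReal.ofReal (l / 32 * (2 * s)) + ENNReal.ofReal (l / 32) * ENNReal.ofReal (2 * s) := by
            gcongr
        _ = _ := by
            rw [← ENNReal.ofReal_mul (by positivity), ← ENNReal.ofReal_add (by positivity) (by positivity)]
            congr 1; ring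
    have h2 : ENNReal.ofReal (2 * π * ‖F (circlePt r x)‖) ≤ ENNReal.ofReal (2 * π * l) := by
      refine hp.trans ?_
      rw [← tsum_geo (l / 16) (2 * π * l) (1 - r) π (by positivity) hδ (by ring) hπ]
      exact ENNReal.tsum_le_tsum fun k => mul_le_mul_right (hk k) _
    rw [ENNReal.ofReal_le_ofReal_iff (by positivity)] at h2
    have : 2 * π * l < 2 * π * ‖F (circlePt r x)‖ := by gcongr
    linarith
  have hw := weak_type_cover v hvfin (l / 32) (by positivity) _ hE
  rw [Measure.restrict_apply' measurableSet_Ioc, ← hv]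
  calc ENNReal.ofReal l * volume ({x | l < (maxRad F x).toReal} ∩ Ioc 0 (2 * π))
      = 32 * (ENNReal.ofReal (l / 32) * volume ({x | l < (maxRad F x).toReal} ∩ Ioc 0 (2 * π))) := by
        rw [← mul_assoc, show (32 : ℝ≥0∞) = ENNReal.ofReal 32 by simp,
          ← ENNReal.ofReal_mul (by norm_num)]
        congr 2; ring
    _ ≤ 32 * (5 * ∫⁻ t, v t) := by gcongr
    _ = _ := by rw [← mul_assoc]; norm_num

/-- the constant -/
def Cst (p : ℝ) : ℝ≥0∞ :=
  (ENNReal.ofReal p * 160 * ENNReal.ofReal ((1 / 32 : ℝ)⁻¹ ^ (p - 1) / (p - 1))) * 2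

lemma Cst_ne_top (p : ℝ) : Cst p ≠ ∞ := by
  unfold Cst
  finiteness

lemma strong_maxRad (p : ℝ) (hp : 1 < p) (F : ℂ → ℂ) (hF : DiffContOnCl ℂ F (Metric.ball 0 1))
    (hc : ContinuousOn F (Metric.closedBall 0 1)) :
    ∫⁻ θ in Ioc 0 (2 * π), maxRad F θ ^ p ≤
      Cst p * ∫⁻ θ in Ioc 0 (2 * π), (‖F (circlePt 1 θ)‖₊ : ℝ≥0∞) ^ p := by
  have hπ := Real.pi_pos
  have hp0 : 0 < p := by linarith
  have hm : Measurable (maxRad F) :=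
    measurable_maxRad F (hc.mono Metric.ball_subset_closedBall)
  obtain ⟨B, hB⟩ := (isCompact_closedBall (0:ℂ) 1).exists_bound_of_continuousOn hc
  have hfin : ∀ θ, maxRad F θ ≠ ∞ := by
    intro θ
    refine ne_top_of_le_ne_top (ENNReal.ofReal_ne_top (r := B)) ?_
    refine iSup₂_le fun r hr => ?_
    change ‖F (circlePt r θ)‖ₑ ≤ _
    rw [← ofReal_norm]
    apply ENNReal.ofReal_le_ofReal
    apply hB
    simp [norm_circlePt, abs_of_nonneg hr.1, hr.2.le]
  have key := marcin p hp (volume.restrict (Ioc 0 (2 * π))) (fun x => (maxRad F x).toReal)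
    hm.ennreal_toReal (fun _ => ENNReal.toReal_nonneg) (wu F) (wu_meas F hc) (wu_nonneg F) 160
    (1 / 32) (by norm_num) (fun l hl => weak_maxRad F hF hc l hl)
  have e1 : ∀ θ, ENNReal.ofReal ((maxRad F θ).toReal ^ p) = maxRad F θ ^ p := by
    intro θ
    rw [← ENNReal.ofReal_rpow_of_nonneg ENNReal.toReal_nonneg hp0.le, ENNReal.ofReal_toReal (hfin θ)]
  simp only [e1] at key
  refine key.trans ?_
  rw [Cst, mul_assoc _ 2]
  gcongr
  have hcont : Continuous (fun t => ‖F (circlePt 1 t)‖ ^ p) :=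
    (cont_bdry F hc).norm.rpow_const (fun _ => Or.inr hp0.le)
  have e2 : ∀ a b : ℝ, a ≤ b → ∫⁻ t in Ioc a b, ENNReal.ofReal (‖F (circlePt 1 t)‖ ^ p) =
      ENNReal.ofReal (∫ t in a..b, ‖F (circlePt 1 t)‖ ^ p) := by
    intro a b hab
    rw [intervalIntegral.integral_of_le hab, ofReal_integral_eq_lintegral_ofReal
      hcont.integrableOn_Ioc (ae_of_all _ fun _ => by positivity)]
  have e3 : ∀ t, ENNReal.ofReal (wu F t ^ p) =
      (Ioc (-π) (3 * π)).indicator (fun t => ENNReal.ofReal (‖F (circlePt 1 t)‖ ^ p)) t := by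
    intro t
    by_cases ht : t ∈ Ioc (-π) (3 * π)
    · simp only [wu, indicator_of_mem ht]
    · simp only [wu, indicator_of_notMem ht]
      simp [Real.zero_rpow hp0.ne']
  have e4 : ∀ t, (‖F (circlePt 1 t)‖₊ : ℝ≥0∞) ^ p = ENNReal.ofReal (‖F (circlePt 1 t)‖ ^ p) := by
    intro t
    rw [← ENNReal.ofReal_rpow_of_nonneg (norm_nonneg _) hp0.le, ofReal_norm]; rfl
  have hper : Function.Periodic (fun t => ‖F (circlePt 1 t)‖ ^ p) (2 * π) := by
    intro t
    simp only [circlePt_periodic 1 t]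
  simp only [e3, e4]
  rw [lintegral_indicator measurableSet_Ioc, e2 _ _ (by linarith), e2 _ _ (by linarith)]
  have h1 := hper.intervalIntegral_add_eq (-π) 0
  have h2 := hper.intervalIntegral_add_eq π 0
  rw [← intervalIntegral.integral_add_adjacent_intervals (b := π)
    (hcont.intervalIntegrable _ _) (hcont.intervalIntegrable _ _)]
  rw [show -π + 2 * π = π by ring, zero_add] at h1
  rw [show π + 2 * π = 3 * π by ring, zero_add] at h2
  rw [h1, h2, show (2 : ℝ≥0∞) = ENNReal.ofReal 2 by simp, ← ENNReal.ofReal_mul (by norm_num), two_mul (∫ t in (0:ℝ)..(2 * π), ‖F (circlePt 1 t)‖ ^ p)]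

lemma circlePt_mul (ρ r θ : ℝ) : (ρ : ℂ) * circlePt r θ = circlePt (ρ * r) θ := by
  simp [circlePt, mul_assoc]

lemma dil_cont (f : ℂ → ℂ) (hf : DifferentiableOn ℂ f unitDisk) (ρ : ℝ) (h0 : 0 ≤ ρ) (h1 : ρ < 1) :
    DifferentiableOn ℂ (fun z => f (ρ * z)) (Metric.closedBall 0 1) := by
  refine hf.comp (by fun_prop) ?_
  intro z hz
  simp only [Metric.mem_closedBall, dist_zero_right] at hz
  simp only [unitDisk, Metric.mem_ball, dist_zero_right, norm_mul, Complex.norm_real,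
    Real.norm_of_nonneg h0]
  nlinarith [norm_nonneg z]

lemma dil_dc (f : ℂ → ℂ) (hf : DifferentiableOn ℂ f unitDisk) (ρ : ℝ) (h0 : 0 ≤ ρ) (h1 : ρ < 1) :
    DiffContOnCl ℂ (fun z => f (ρ * z)) (Metric.ball 0 1) := by
  apply DifferentiableOn.diffContOnCl
  rw [closure_ball _ one_ne_zero]
  exact dil_cont f hf ρ h0 h1

lemma cont_circle (f : ℂ → ℂ) (hf : DifferentiableOn ℂ f unitDisk) (r : ℝ) (h0 : 0 ≤ r) (h1 : r < 1) :
    Continuous (fun θ => f (circlePt r θ)) := by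
  rw [← continuousOn_univ]
  refine hf.continuousOn.comp (continuous_circlePt r).continuousOn ?_
  intro θ _
  simp [unitDisk, norm_circlePt, abs_of_nonneg h0, h1]

lemma strong_limit (p : ℝ) (hp : 1 < p) (f : ℂ → ℂ) (hf : DifferentiableOn ℂ f unitDisk)
    (ρ : ℕ → ℝ) (hρ : ∀ n, ρ n ∈ Ico (0:ℝ) 1) (hlim : Tendsto ρ atTop (𝓝 1)) :
    ∫⁻ θ in Ioc 0 (2 * π), maxRad f θ ^ p ≤ Cst p *
      liminf (fun n => ∫⁻ θ in Ioc 0 (2 * π), (‖f (circlePt (ρ n) θ)‖₊ : ℝ≥0∞) ^ p) atTop := by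
  have hp0 : 0 < p := by linarith
  set F : ℕ → ℂ → ℂ := fun n z => f (ρ n * z)
  have h1 : ∀ n, ∫⁻ θ in Ioc 0 (2 * π), maxRad (F n) θ ^ p ≤
      Cst p * ∫⁻ θ in Ioc 0 (2 * π), (‖f (circlePt (ρ n) θ)‖₊ : ℝ≥0∞) ^ p := by
    intro n
    have := strong_maxRad p hp (F n) (dil_dc f hf (ρ n) (hρ n).1 (hρ n).2)
      (dil_cont f hf (ρ n) (hρ n).1 (hρ n).2).continuousOn
    simpa only [F, circlePt_mul, mul_one] using this
  have h2 : ∀ θ, maxRad f θ ^ p ≤ liminf (fun n => maxRad (F n) θ ^ p) atTop := by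
    intro θ
    refine le_of_forall_lt fun c hc => ?_
    obtain ⟨c', hcc', hc'⟩ := exists_between hc
    refine hcc'.trans_le ?_
    have h3 : c' ^ (1 / p) < maxRad f θ := by
      rw [one_div, ENNReal.rpow_inv_lt_iff hp0]
      exact hc'
    simp only [maxRad, lt_iSup_iff] at h3
    obtain ⟨r, hr, hlr⟩ := h3
    have hev : ∀ᶠ n in atTop, r < ρ n := hlim.eventually_const_lt hr.2
    refine le_liminf_of_le (by isBoundedDefault) ?_
    filter_upwards [hev] with n hn
    rw [← ENNReal.rpow_inv_le_iff hp0, ← one_div]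
    refine hlr.le.trans ?_
    have hpos : 0 < ρ n := hr.1.trans_lt hn
    have : (‖f (circlePt r θ)‖₊ : ℝ≥0∞) = (‖F n (circlePt (r / ρ n) θ)‖₊ : ℝ≥0∞) := by
      simp only [F, circlePt_mul]
      rw [mul_div_cancel₀ _ hpos.ne']
    rw [this]
    exact le_iSup₂ (f := fun r (_ : r ∈ Ico (0:ℝ) 1) => (‖F n (circlePt r θ)‖₊ : ℝ≥0∞)) (r / ρ n)
      ⟨div_nonneg hr.1 hpos.le, (div_lt_one hpos).2 hn⟩
  calc _ ≤ ∫⁻ θ in Ioc 0 (2 * π), liminf (fun n => maxRad (F n) θ ^ p) atTop := lintegral_mono h2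
    _ ≤ liminf (fun n => ∫⁻ θ in Ioc 0 (2 * π), maxRad (F n) θ ^ p) atTop := by
      apply lintegral_liminf_le
      intro n
      exact (measurable_maxRad _ ((dil_cont f hf (ρ n) (hρ n).1 (hρ n).2).continuousOn.mono
        Metric.ball_subset_closedBall)).pow_const p
    _ ≤ liminf (fun n => Cst p * ∫⁻ θ in Ioc 0 (2 * π), (‖f (circlePt (ρ n) θ)‖₊ : ℝ≥0∞) ^ p) atTop :=
      liminf_le_liminf (Eventually.of_forall h1)
    _ = _ := ENNReal.liminf_const_mul_of_ne_top (Cst_ne_top p)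

lemma hilbert_lim {E : Type*} [NormedAddCommGroup E] [InnerProductSpace ℂ E] [CompleteSpace E]
    (H : ℕ → E) (R : ℝ) (hR : ∀ n, ‖H n‖ ≤ R) :
    ∃ g : E, ∀ φ : E, Tendsto (fun n => inner ℂ (H n) φ) (hyperfilter ℕ) (𝓝 (inner ℂ g φ)) := by
  set T : ℕ → WeakDual ℂ E := fun n => StrongDual.toWeakDual (InnerProductSpace.toDual ℂ E (H n))
  have hK := WeakDual.isCompact_closedBall (𝕜 := ℂ) (E := E) (0 : StrongDual ℂ E) R
  obtain ⟨Λ, -, hΛ⟩ := hK.ultrafilter_le_nhds ((hyperfilter ℕ).map T) (by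
    rw [Filter.le_principal_iff]
    refine Filter.mem_map.2 (Filter.univ_mem' fun n => ?_)
    simp [T, hR n])
  refine ⟨(InnerProductSpace.toDual ℂ E).symm (WeakDual.toStrongDual Λ), fun φ => ?_⟩
  have hT : Tendsto T (hyperfilter ℕ) (𝓝 Λ) := hΛ
  have h2 : Tendsto (fun n => T n φ) (hyperfilter ℕ) (𝓝 (Λ φ)) :=
    ((WeakDual.eval_continuous φ).tendsto Λ).comp hT
  have e : inner ℂ ((InnerProductSpace.toDual ℂ E).symm (WeakDual.toStrongDual Λ)) φ = Λ φ := by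
    rw [InnerProductSpace.toDual_symm_apply]; rfl
  rw [e]
  exact h2

lemma weak_lim (μ : Measure ℝ) (h : ℕ → ℝ → ℂ) (hm : ∀ n, MemLp (h n) 2 μ) (sw : ℝ → ℝ)
    (hsw : MemLp sw 2 μ) (hb : ∀ n, ∀ᵐ t ∂μ, ‖h n t‖ ≤ sw t) :
    ∃ g : ℝ → ℂ, Measurable g ∧ MemLp g 2 μ ∧ ∀ φ : ℝ → ℂ, MemLp φ 2 μ → ∀ l : ℂ,
      Tendsto (fun n => ∫ t, h n t * φ t ∂μ) atTop (𝓝 l) → ∫ t, g t * φ t ∂μ = l := by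
  obtain ⟨g0, hg0⟩ := hilbert_lim (fun n => (hm n).toLp (h n)) (eLpNorm sw 2 μ).toReal (by
    intro n
    rw [Lp.norm_toLp]
    refine ENNReal.toReal_mono hsw.2.ne (eLpNorm_mono_ae_real (hb n)))
  have hsm := (Lp.aestronglyMeasurable g0).aemeasurable
  refine ⟨hsm.mk _, hsm.measurable_mk, (memLp_congr_ae hsm.ae_eq_mk).1 (Lp.memLp g0), ?_⟩
  intro φ hφ l hl
  have hφ' : MemLp (fun t => (starRingEnd ℂ) (φ t)) 2 μ := hφ.star
  have key := hg0 (hφ'.toLp _)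
  have e1 : ∀ n, inner ℂ ((hm n).toLp (h n)) (hφ'.toLp _) =
      (starRingEnd ℂ) (∫ t, h n t * φ t ∂μ) := by
    intro n
    rw [L2.inner_def, ← integral_conj]
    apply integral_congr_ae
    filter_upwards [(hm n).coeFn_toLp, hφ'.coeFn_toLp] with t h1 h2
    rw [h1, h2]
    simp [mul_comm]
  have e2 : inner ℂ g0 (hφ'.toLp _) = (starRingEnd ℂ) (∫ t, hsm.mk _ t * φ t ∂μ) := by
    rw [L2.inner_def, ← integral_conj]
    apply integral_congr_ae
    filter_upwards [hsm.ae_eq_mk, hφ'.coeFn_toLp] with t h1 h2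
    rw [h1, h2]
    simp [mul_comm]
  rw [e2] at key
  simp only [e1] at key
  have hl' : Tendsto (fun n => (starRingEnd ℂ) (∫ t, h n t * φ t ∂μ)) (hyperfilter ℕ)
      (𝓝 ((starRingEnd ℂ) l)) :=
    ((Complex.continuous_conj.tendsto l).comp hl).mono_left Nat.hyperfilter_le_atTop
  exact (starRingEnd ℂ).injective (tendsto_nhds_unique key hl')

lemma poisson_rep (f : ℂ → ℂ) (hf : DifferentiableOn ℂ f unitDisk)
    (hfin : ∫⁻ θ in Ioc 0 (2 * π), maxRad f θ ≠ ∞)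
    (ρ : ℕ → ℝ) (hρ : ∀ n, ρ n ∈ Ico (0:ℝ) 1) (hlim : Tendsto ρ atTop (𝓝 1)) :
    ∃ g : ℝ → ℂ, Measurable g ∧ IntegrableOn g (Ioc 0 (2 * π)) ∧
      ∀ r θ : ℝ, 0 ≤ r → r < 1 →
        ∫ t in Ioc 0 (2 * π), (pk r θ t : ℂ) * g t = 2 * π * f (circlePt r θ) := by
  set μ := (volume : Measure ℝ).restrict (Ioc 0 (2 * π)) with hμ
  have : IsFiniteMeasure μ := by rw [hμ]; infer_instance
  have hmm := measurable_maxRad f hf.continuousOn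
  have hae : ∀ᵐ t ∂μ, maxRad f t < ∞ := ae_lt_top hmm hfin
  set w : ℝ → ℝ := fun t => 1 + (maxRad f t).toReal with hw
  have hw1 : ∀ t, 1 ≤ w t := fun t => by simp [hw]
  have hwm : Measurable w := hmm.ennreal_toReal.const_add 1
  have hwi : Integrable w μ :=
    (integrable_const _).add (integrable_toReal_of_lintegral_ne_top hmm.aemeasurable hfin)
  set sw : ℝ → ℝ := fun t => √(w t) with hsw
  have hsw1 : ∀ t, 1 ≤ sw t := fun t => Real.one_le_sqrt.2 (hw1 t)
  have hswsq : ∀ t, sw t * sw t = w t := fun t =>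
    Real.mul_self_sqrt (by linarith [hw1 t])
  have hswm : Measurable sw := hwm.sqrt
  have hsw2 : MemLp sw 2 μ := by
    rw [memLp_two_iff_integrable_sq hswm.aestronglyMeasurable]
    simpa only [sq, hswsq] using hwi
  have hfm : ∀ n, Measurable (fun t => f (circlePt (ρ n) t)) := fun n =>
    (cont_circle f hf _ (hρ n).1 (hρ n).2).measurable
  set h : ℕ → ℝ → ℂ := fun n t => f (circlePt (ρ n) t) / (sw t : ℂ) with hh
  have hhm : ∀ n, Measurable (h n) := fun n => (hfm n).div (Complex.measurable_ofReal.comp hswm)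
  have hb : ∀ n, ∀ᵐ t ∂μ, ‖h n t‖ ≤ sw t := by
    intro n
    filter_upwards [hae] with t ht
    have h1 : ‖f (circlePt (ρ n) t)‖ ≤ (maxRad f t).toReal := by
      have : (‖f (circlePt (ρ n) t)‖₊ : ℝ≥0∞) ≤ maxRad f t :=
        le_iSup₂ (f := fun r (_ : r ∈ Ico (0:ℝ) 1) => (‖f (circlePt r t)‖₊ : ℝ≥0∞)) (ρ n) (hρ n)
      have := ENNReal.toReal_mono ht.ne this
      simpa using this
    have hpos : 0 < sw t := by linarith [hsw1 t]
    simp only [hh, norm_div, Complex.norm_real, Real.norm_of_nonneg hpos.le]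
    rw [div_le_iff₀ hpos, hswsq]
    simp only [hw]; linarith
  have hm2 : ∀ n, MemLp (h n) 2 μ := by
    intro n
    refine hsw2.mono (hhm n).aestronglyMeasurable ?_
    filter_upwards [hb n] with t ht
    exact ht.trans (le_abs_self _)
  obtain ⟨g0, hg0m, hg02, hg0⟩ := weak_lim μ h hm2 sw hsw2 hb
  have hsw2c : MemLp (fun t => (sw t : ℂ)) 2 μ := hsw2.ofReal
  refine ⟨fun t => g0 t * sw t, hg0m.mul (Complex.measurable_ofReal.comp hswm),
    hg02.integrable_mul hsw2c, fun r θ h0 h1 => ?_⟩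
  obtain ⟨B, hB⟩ : ∃ B, ∀ t, ‖pk r θ t‖ ≤ B :=
    ⟨(1 - r ^ 2) / (1 - r) ^ 2, fun t => by
      rw [Real.norm_of_nonneg (pk_nonneg r θ t h0 h1)]
      have := dist_ge r θ t h0 h1
      have h3 : 0 < 1 - r := by linarith
      have h4 : 0 ≤ 1 - r ^ 2 := by nlinarith
      unfold pk
      gcongr⟩
  have hφ : MemLp (fun t => (pk r θ t : ℂ) * (sw t : ℂ)) 2 μ := by
    have hpc : Continuous (fun t => (pk r θ t : ℂ)) :=
      Complex.continuous_ofReal.comp (continuous_pk r θ h0 h1)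
    refine hsw2c.of_le_mul (c := B)
      (hpc.measurable.mul (Complex.measurable_ofReal.comp hswm)).aestronglyMeasurable
      (ae_of_all _ fun t => ?_)
    rw [norm_mul, Complex.norm_real (pk r θ t)]
    gcongr
    exact hB t
  have hfinal := hg0 _ hφ (2 * π * f (circlePt r θ)) ?_
  · rw [← hfinal]
    congr 1
    ext t
    ring
  · have e : ∀ n, ∫ t, h n t * ((pk r θ t : ℂ) * (sw t : ℂ)) ∂μ =
        2 * π * f (circlePt (ρ n * r) θ) := by
      intro n
      have := poisson_formula _ (dil_dc f hf (ρ n) (hρ n).1 (hρ n).2) r θ h0 h1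
      simp only [circlePt_mul, mul_one] at this
      rw [← this, intervalIntegral.integral_of_le (by positivity)]
      congr 1
      ext t
      have : (sw t : ℂ) ≠ 0 := by
        have : sw t ≠ 0 := by linarith [hsw1 t]
        exact_mod_cast this
      simp only [hh]
      field_simp
    simp only [e]
    refine Tendsto.const_mul _ ?_
    have hmem : circlePt r θ ∈ unitDisk := by
      simp [unitDisk, norm_circlePt, abs_of_nonneg h0, h1]
    have hc : ContinuousAt f (circlePt r θ) :=
      hf.continuousOn.continuousAt (Metric.isOpen_ball.mem_nhds hmem)
    refine hc.tendsto.comp ?_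
    have : Tendsto (fun n => (ρ n : ℂ) * circlePt r θ) atTop (𝓝 (((1:ℝ) : ℂ) * circlePt r θ)) :=
      ((Complex.continuous_ofReal.tendsto 1).comp hlim).mul_const _
    simpa [circlePt_mul] using this

lemma tsum_small (φ : ℝ → ℝ≥0∞) (a : ℝ) (ha : 0 < a) (B : ℝ≥0∞) (hB : B ≠ ∞)
    (hφ : ∀ s > 0, φ s ≤ B) (hlim : Tendsto φ (𝓝[>] 0) (𝓝 0)) :
    Tendsto (fun r : ℝ => ∑' k : ℕ, ENNReal.ofReal (16 * a / 2 ^ k) * φ (a * 2 ^ k * (1 - r)))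
      (𝓝[<] 1) (𝓝 0) := by
  have hr : ∀ᶠ r : ℝ in 𝓝[<] 1, r < 1 := self_mem_nhdsWithin
  have h := tendsto_lintegral_filter_of_dominated_convergence (μ := (Measure.count : Measure ℕ))
    (l := 𝓝[<] (1:ℝ))
    (F := fun r k => ENNReal.ofReal (16 * a / 2 ^ k) * φ (a * 2 ^ k * (1 - r)))
    (f := fun _ => 0) (fun k => ENNReal.ofReal (16 * a / 2 ^ k) * B)
    (Eventually.of_forall fun _ => measurable_from_top) ?_ ?_ ?_
  · simpa only [lintegral_count, tsum_zero] using h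
  · filter_upwards [hr] with r hr
    refine ae_of_all _ fun k => ?_
    gcongr
    apply hφ
    have : 0 < 1 - r := by linarith
    positivity
  · rw [lintegral_count, ENNReal.tsum_mul_right]
    refine ENNReal.mul_ne_top ?_ hB
    have hs : Summable (fun k : ℕ => 16 * a / 2 ^ k) := by
      have := (summable_geometric_two).mul_left (16 * a)
      refine this.congr fun k => ?_
      simp [div_eq_mul_inv]
    exact hs.tsum_ofReal_ne_top
  · refine ae_of_all _ fun k => ?_
    have h1 : Tendsto (fun r : ℝ => a * 2 ^ k * (1 - r)) (𝓝[<] 1) (𝓝[>] 0) := by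
      refine tendsto_nhdsWithin_iff.2 ⟨?_, ?_⟩
      · have : Continuous (fun r : ℝ => a * 2 ^ k * (1 - r)) := by fun_prop
        have := this.tendsto 1
        simp only [sub_self, mul_zero] at this
        exact this.mono_left nhdsWithin_le_nhds
      · filter_upwards [hr] with r hr
        have : 0 < 1 - r := by linarith
        exact mem_Ioi.2 (by positivity)
    have := ENNReal.Tendsto.const_mul (a := ENNReal.ofReal (16 * a / 2 ^ k)) (hlim.comp h1)
      (Or.inr ENNReal.ofReal_ne_top)
    simpa using this

lemma leb_pt (G : ℝ → ℂ) (hG : Integrable G) :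
    ∀ᵐ θ : ℝ, Tendsto (fun s : ℝ => (∫⁻ y in Metric.closedBall θ s, ‖G y - G θ‖ₑ) /
      ENNReal.ofReal (2 * s)) (𝓝[>] 0) (𝓝 0) := by
  filter_upwards [(IsUnifLocDoublingMeasure.vitaliFamily (volume : Measure ℝ)
    1).ae_tendsto_lintegral_enorm_sub_div hG.locallyIntegrable] with θ hθ
  have h1 : Tendsto (fun s : ℝ => Metric.closedBall θ s) (𝓝[>] 0)
      ((IsUnifLocDoublingMeasure.vitaliFamily (volume : Measure ℝ) 1).filterAt θ) := by
    refine IsUnifLocDoublingMeasure.tendsto_closedBall_filterAt volume (fun _ => θ) (fun s => s)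
      tendsto_id ?_
    filter_upwards [self_mem_nhdsWithin] with s hs
    have : (0:ℝ) < s := hs
    simp [this.le]
  have := hθ.comp h1
  refine this.congr fun s => ?_
  simp [Real.volume_closedBall]

lemma avg_bdd (G : ℝ → ℂ) (hG : Integrable G) (θ : ℝ)
    (h : Tendsto (fun s : ℝ => (∫⁻ y in Metric.closedBall θ s, ‖G y - G θ‖ₑ) /
      ENNReal.ofReal (2 * s)) (𝓝[>] 0) (𝓝 0)) :
    ∃ B : ℝ≥0∞, B ≠ ∞ ∧ ∀ s > 0, (∫⁻ y in Metric.closedBall θ s, ‖G y - G θ‖ₑ) /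
      ENNReal.ofReal (2 * s) ≤ B := by
  have h1 := h.eventually_lt_const (zero_lt_one)
  rw [eventually_nhdsWithin_iff, Metric.eventually_nhds_iff] at h1
  obtain ⟨ε, hε, h1⟩ := h1
  refine ⟨1 + ((∫⁻ y, ‖G y‖ₑ) / ENNReal.ofReal (2 * ε) + ‖G θ‖ₑ), ?_, ?_⟩
  · have h3 : ∫⁻ y, ‖G y‖ₑ ≠ ∞ := hG.2.ne
    have : ENNReal.ofReal (2 * ε) ≠ 0 := by simp [hε]
    finiteness
  · intro s hs
    by_cases hse : s < ε
    · exact (h1 (by simpa [abs_of_pos hs] using hse) hs).le.trans le_self_add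
    · push Not at hse
      refine le_trans ?_ le_add_self
      have h4 : ∫⁻ y in Metric.closedBall θ s, ‖G y - G θ‖ₑ ≤
          (∫⁻ y, ‖G y‖ₑ) + ‖G θ‖ₑ * ENNReal.ofReal (2 * s) := by
        calc _ ≤ ∫⁻ y in Metric.closedBall θ s, (‖G y‖ₑ + ‖G θ‖ₑ) :=
              lintegral_mono fun y => enorm_sub_le
          _ = (∫⁻ y in Metric.closedBall θ s, ‖G y‖ₑ) + ‖G θ‖ₑ * ENNReal.ofReal (2 * s) := by
              rw [lintegral_add_right _ measurable_const]; simp [Real.volume_closedBall]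
          _ ≤ _ := by gcongr; exact Measure.restrict_le_self
      have hs0 : ENNReal.ofReal (2 * s) ≠ 0 := by simp [hs]
      calc _ ≤ ((∫⁻ y, ‖G y‖ₑ) + ‖G θ‖ₑ * ENNReal.ofReal (2 * s)) / ENNReal.ofReal (2 * s) := by
            gcongr
        _ = (∫⁻ y, ‖G y‖ₑ) / ENNReal.ofReal (2 * s) + ‖G θ‖ₑ := by
            rw [ENNReal.add_div, ENNReal.mul_div_cancel_right hs0 ENNReal.ofReal_ne_top]
        _ ≤ _ := by gcongr

lemma fatou (f : ℂ → ℂ) (g : ℝ → ℂ) (hgm : Measurable g) (hgi : IntegrableOn g (Ioc 0 (2 * π)))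
    (hrep : ∀ r θ : ℝ, 0 ≤ r → r < 1 →
        ∫ t in Ioc 0 (2 * π), (pk r θ t : ℂ) * g t = 2 * π * f (circlePt r θ)) :
    ∀ᵐ θ ∂(volume.restrict (Ioc 0 (2 * π))),
      Tendsto (fun r : ℝ => f (circlePt r θ)) (𝓝[<] 1) (𝓝 (g θ)) := by
  set G : ℝ → ℂ := (Ioc 0 (2 * π)).indicator g with hG
  have hGi : Integrable G := (integrable_indicator_iff measurableSet_Ioc).2 hgi
  have hGm : Measurable G := hgm.indicator measurableSet_Ioc
  have hne : ∀ᵐ θ : ℝ, θ ≠ 2 * π := by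
    simp [ae_iff]
  filter_upwards [ae_restrict_of_ae (leb_pt G hGi), ae_restrict_of_ae hne,
    ae_restrict_mem measurableSet_Ioc] with θ hL hne hθ
  have hGθ : G θ = g θ := indicator_of_mem hθ g
  obtain ⟨B, hB, hφB⟩ := avg_bdd G hGi θ hL
  obtain ⟨c, hc, hch⟩ := chord2 θ hθ.1 (lt_of_le_of_ne hθ.2 hne)
  have ha : 0 < 2 / c := by positivity
  have hT := tsum_small _ (2 / c) ha B hB hφB hL
  rw [tendsto_iff_edist_tendsto_0]
  have h2π : ENNReal.ofReal (2 * π) ≠ 0 := by simp [Real.pi_pos]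
  have hT2 := ENNReal.Tendsto.div_const hT (b := ENNReal.ofReal (2 * π)) (Or.inr h2π)
  rw [ENNReal.zero_div] at hT2
  refine tendsto_of_tendsto_of_tendsto_of_le_of_le' tendsto_const_nhds hT2
    (Eventually.of_forall fun _ => zero_le) ?_
  have hr0 : ∀ᶠ r : ℝ in 𝓝[<] 1, 0 < r :=
    nhdsWithin_le_nhds (lt_mem_nhds zero_lt_one)
  have hr1 : ∀ᶠ r : ℝ in 𝓝[<] 1, r < 1 := self_mem_nhdsWithin
  filter_upwards [hr0, hr1] with r h0 h1
  have hd : 0 < 1 - r := by linarith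
  rw [ENNReal.le_div_iff_mul_le (Or.inl h2π) (Or.inl ENNReal.ofReal_ne_top)]
  have hpc : Continuous (fun t => (pk r θ t : ℂ)) :=
    Complex.continuous_ofReal.comp (continuous_pk r θ h0.le h1)
  have e1 : ∫ t in Ioc 0 (2 * π), (pk r θ t : ℂ) * (G t - G θ) =
      2 * π * (f (circlePt r θ) - g θ) := by
    have e2 : ∫ t in Ioc 0 (2 * π), (pk r θ t : ℂ) * (G t - G θ) =
        ∫ t in Ioc 0 (2 * π), ((pk r θ t : ℂ) * g t - (pk r θ t : ℂ) * g θ) := by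
      refine setIntegral_congr_fun measurableSet_Ioc fun t ht => ?_
      simp only [hGθ]
      rw [hG, indicator_of_mem ht]; ring
    have e3 := poisson_one r θ h0.le h1
    rw [intervalIntegral.integral_of_le (by positivity)] at e3
    obtain ⟨b, hb⟩ : ∃ B, ∀ t, ‖(pk r θ t : ℂ)‖ ≤ B :=
      ⟨(1 - r ^ 2) / (1 - r) ^ 2, fun t => by
        rw [Complex.norm_real, Real.norm_of_nonneg (pk_nonneg r θ t h0.le h1)]
        have := dist_ge r θ t h0.le h1
        have h4 : 0 ≤ 1 - r ^ 2 := by nlinarith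
        unfold pk
        gcongr⟩
    rw [e2, integral_sub, hrep r θ h0.le h1, integral_mul_const, e3]
    · ring
    · exact hgi.bdd_mul hpc.aestronglyMeasurable (ae_of_all _ hb)
    · exact (hpc.mul continuous_const).integrableOn_Ioc
  have e4 : edist (f (circlePt r θ)) (g θ) * ENNReal.ofReal (2 * π) =
      ‖∫ t in Ioc 0 (2 * π), (pk r θ t : ℂ) * (G t - G θ)‖ₑ := by
    rw [e1, enorm_mul, edist_eq_enorm_sub, mul_comm]
    congr 1
    rw [← ofReal_norm]
    congr 1
    simp [abs_of_pos Real.pi_pos]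
  rw [e4]
  calc _ ≤ ∫⁻ t in Ioc 0 (2 * π), ‖(pk r θ t : ℂ) * (G t - G θ)‖ₑ :=
        enorm_integral_le_lintegral_enorm _
    _ = ∫⁻ t in Ioc 0 (2 * π), ENNReal.ofReal (pk r θ t) * ‖G t - G θ‖ₑ := by
        congr 1
        ext t
        rw [enorm_mul, ← ofReal_norm (pk r θ t : ℂ), Complex.norm_real,
          Real.norm_of_nonneg (pk_nonneg r θ t h0.le h1)]
    _ ≤ _ := kernel_int r θ (2 / c) h0.le h1 ha _ measurableSet_Ioc
        (fun t ht => dist_le_aux r θ t c h0.le h1 hc (hch t ht)) _ (hGm.sub_const _).enorm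
    _ = _ := by
        refine tsum_congr fun k => ?_
        set I := ∫⁻ t in Metric.closedBall θ (2 / c * 2 ^ k * (1 - r)), ‖G t - G θ‖ₑ
        have hp : 0 < 2 * (2 / c * 2 ^ k * (1 - r)) := by positivity
        rw [div_eq_mul_inv I, mul_comm I (ENNReal.ofReal _)⁻¹, ← mul_assoc, ← ENNReal.ofReal_inv_of_pos hp,
          ← ENNReal.ofReal_mul (by positivity)]
        congr 2
        have e5 : (4:ℝ) ^ k = 2 ^ k * 2 ^ k := by rw [← mul_pow]; norm_num
        rw [e5]
        field_simp
        norm_num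

/-- Hardy–Littlewood maximal theorem. For `1 < p < ∞` there is a constant
`C_p` depending only on `p` such that for every `f ∈ H^p` the radial limit `f*` exists a.e.,
the maximal function `Mf` lies in `L^p(𝕋)`, and
`∫₀^{2π} (Mf(θ))^p dθ/2π ≤ C_p ∫₀^{2π} |f*(e^{iθ})|^p dθ/2π`. -/
theorem hardy_littlewood_maximal (p : ℝ) (hp : 1 < p) :
    ∃ C : ℝ≥0∞, C ≠ ∞ ∧ ∀ f ∈ HpClass p,
      (∀ᵐ θ ∂(volume.restrict (Set.Ioc 0 (2 * π))),
        ∃ l : ℂ, Tendsto (fun r : ℝ => f (circlePt r θ)) (nhdsWithin 1 (Set.Iio 1)) (nhds l)) ∧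
      (∫⁻ θ in Set.Ioc 0 (2 * π), maxRad f θ ^ p) / ENNReal.ofReal (2 * π) < ∞ ∧
      (∫⁻ θ in Set.Ioc 0 (2 * π), maxRad f θ ^ p) / ENNReal.ofReal (2 * π) ≤
        C * ((∫⁻ θ in Set.Ioc 0 (2 * π), (‖radialLimit f θ‖₊ : ℝ≥0∞) ^ p) /
          ENNReal.ofReal (2 * π)) := by
  have hp0 : 0 < p := by linarith
  have h2π : ENNReal.ofReal (2 * π) ≠ 0 := by simp [Real.pi_pos]
  have h2π' : ENNReal.ofReal (2 * π) ≠ ∞ := ENNReal.ofReal_ne_top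
  refine ⟨Cst p, Cst_ne_top p, fun f hfH => ?_⟩
  obtain ⟨hf, hK⟩ := hfH
  set ρ : ℕ → ℝ := fun n => 1 - 1 / ((n : ℝ) + 1) with hρdef
  have hρ : ∀ n, ρ n ∈ Ico (0:ℝ) 1 := by
    intro n
    have h1 : (0:ℝ) < (n : ℝ) + 1 := by positivity
    have h2 : 1 / ((n : ℝ) + 1) ≤ 1 := by
      rw [div_le_one h1]; simp
    have h3 : 0 < 1 / ((n : ℝ) + 1) := by positivity
    exact ⟨by simp only [hρdef]; linarith, by simp only [hρdef]; linarith⟩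
  have hlim : Tendsto ρ atTop (𝓝 1) := by
    have := (tendsto_one_div_add_atTop_nhds_zero_nat (𝕜 := ℝ)).const_sub 1
    simpa [hρdef] using this
  have hlim' : Tendsto ρ atTop (𝓝[<] 1) :=
    tendsto_nhdsWithin_iff.2 ⟨hlim, Eventually.of_forall fun n => (hρ n).2⟩
  have hmm := measurable_maxRad f hf.continuousOn
  have hle : ∀ n θ, (‖f (circlePt (ρ n) θ)‖₊ : ℝ≥0∞) ≤ maxRad f θ := fun n θ =>
    le_iSup₂ (f := fun r (_ : r ∈ Ico (0:ℝ) 1) => (‖f (circlePt r θ)‖₊ : ℝ≥0∞)) (ρ n) (hρ n)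
  set K := ⨆ r ∈ Set.Ico (0 : ℝ) 1,
      (∫⁻ θ in Set.Ioc 0 (2 * π), (‖f (circlePt r θ)‖₊ : ℝ≥0∞) ^ p) / ENNReal.ofReal (2 * π)
    with hKdef
  have hI : ∀ n, ∫⁻ θ in Ioc 0 (2 * π), (‖f (circlePt (ρ n) θ)‖₊ : ℝ≥0∞) ^ p ≤
      K * ENNReal.ofReal (2 * π) := by
    intro n
    rw [← ENNReal.div_le_iff h2π h2π']
    exact le_iSup₂ (f := fun r (_ : r ∈ Ico (0:ℝ) 1) =>
      (∫⁻ θ in Set.Ioc 0 (2 * π), (‖f (circlePt r θ)‖₊ : ℝ≥0∞) ^ p) / ENNReal.ofReal (2 * π))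
      (ρ n) (hρ n)
  have hmain := strong_limit p hp f hf ρ hρ hlim
  have hfinp : ∫⁻ θ in Ioc 0 (2 * π), maxRad f θ ^ p ≠ ∞ := by
    refine ne_top_of_le_ne_top ?_ hmain
    refine ENNReal.mul_ne_top (Cst_ne_top p) ?_
    refine ne_top_of_le_ne_top (ENNReal.mul_ne_top hK.ne h2π') ?_
    refine (liminf_le_liminf (Eventually.of_forall hI)).trans ?_
    rw [liminf_const]
  have hfin1 : ∫⁻ θ in Ioc 0 (2 * π), maxRad f θ ≠ ∞ := by
    have h1 : ∫⁻ θ in Ioc 0 (2 * π), maxRad f θ ≤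
        ∫⁻ θ in Ioc 0 (2 * π), (1 + maxRad f θ ^ p) := by
      refine lintegral_mono fun θ => ?_
      rcases le_total (maxRad f θ) 1 with h | h
      · exact h.trans le_self_add
      · refine le_trans ?_ le_add_self
        calc maxRad f θ = maxRad f θ ^ (1:ℝ) := (ENNReal.rpow_one _).symm
          _ ≤ _ := ENNReal.rpow_le_rpow_of_exponent_le h hp.le
    refine ne_top_of_le_ne_top ?_ h1
    rw [lintegral_add_left measurable_const]
    refine ENNReal.add_ne_top.2 ⟨?_, hfinp⟩
    simp
    finiteness
  obtain ⟨g, hgm, hgi, hrep⟩ := poisson_rep f hf hfin1 ρ hρ hlim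
  have hfat := fatou f g hgm hgi hrep
  have hrad : ∀ᵐ θ ∂(volume.restrict (Ioc 0 (2 * π))), radialLimit f θ = g θ := by
    filter_upwards [hfat] with θ hθ
    exact hθ.limUnder_eq
  have hconv : Tendsto (fun n => ∫⁻ θ in Ioc 0 (2 * π), (‖f (circlePt (ρ n) θ)‖₊ : ℝ≥0∞) ^ p)
      atTop (𝓝 (∫⁻ θ in Ioc 0 (2 * π), (‖radialLimit f θ‖₊ : ℝ≥0∞) ^ p)) := by
    refine tendsto_lintegral_of_dominated_convergence (fun θ => maxRad f θ ^ p) ?_ ?_ hfinp ?_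
    · intro n
      exact (cont_circle f hf _ (hρ n).1 (hρ n).2).measurable.enorm.pow_const p
    · intro n
      refine ae_of_all _ fun θ => ?_
      exact ENNReal.rpow_le_rpow (hle n θ) hp0.le
    · filter_upwards [hfat, hrad] with θ h1 h2
      rw [h2]
      have h3 : Tendsto (fun n => ‖f (circlePt (ρ n) θ)‖ₑ) atTop (𝓝 ‖g θ‖ₑ) :=
        (h1.comp hlim').enorm
      exact (ENNReal.continuous_rpow_const.tendsto _).comp h3
  rw [hconv.liminf_eq] at hmain
  refine ⟨?_, ENNReal.div_lt_top hfinp h2π, ?_⟩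
  · filter_upwards [hfat] with θ hθ
    exact ⟨_, hθ⟩
  · rw [← mul_div_assoc]
    exact ENNReal.div_le_div_right hmain _
end
end

section
/- Let B be an infinite Blaschke product with zero sequence {a_k}_{k=1}^∞ in 𝔻 \ {0} satisfying Σ_k (1 − |a_k|) < ∞. For each positive integer n define the tail product g_n(z) = Π_{k=n+1}^∞ (|a_k|/a_k)·(a_k − z)/(1 − ā_k z), z ∈ 𝔻. Then for each p > 1, g_n → 1 in the metric space (M^p, ρ_p) as n → ∞, i.e., ρ_p(g_n, 1) → 0. -/
open MeasureTheory Filter Set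
open scoped ENNReal Topology Real NNReal

noncomputable section

lemma abs_max {μ ν : Measure ℝ} [IsFiniteMeasure μ] [IsFiniteMeasure ν] (hνμ : ν ≤ μ)
    (H : ℝ → ℝ → ℝ) (hH : Measurable (Function.uncurry H)) (h0 : ∀ x y, 0 ≤ H x y)
    (M : ℝ) (hM : ∀ x y, H x y ≤ M) (A C : ℝ) (hA0 : 0 < A) (hC0 : 0 < C)
    (hA : ∀ x, ∫ y, H x y ∂μ = A)
    (hC : ∀ x y, ∫ t, H x t * H y t ∂μ ≤ C * (H x y + H y x))
    (u : ℝ → ℝ) (hu : Measurable u) (Mu : ℝ) (hMu : ∀ t, |u t| ≤ Mu)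
    (l : ℝ) (hl0 : 0 < l) (hl : ∀ᵐ x ∂ν, l ≤ ∫ t, H x t * u t ∂μ) :
    ν.real univ ≤ 2 * C * A / l ^ 2 * ∫ t, u t ^ 2 ∂μ := by
  have hM0 : 0 ≤ M := (h0 0 0).trans (hM 0 0)
  have hMu0 : 0 ≤ Mu := (abs_nonneg _).trans (hMu 0)
  have habs : ∀ x y, |H x y| ≤ M := fun x y => by rw [abs_of_nonneg (h0 x y)]; exact hM x y
  have hHc : ∀ {f g : ℝ × ℝ → ℝ}, Measurable f → Measurable g →
      Measurable fun p => H (f p) (g p) := fun hf hg => hH.comp (hf.prodMk hg)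
  set m := ν.real univ with hm
  set K : ℝ → ℝ := fun t => ∫ x, H x t ∂ν with hK
  have hKm : Measurable K := by
    have : StronglyMeasurable K :=
      StronglyMeasurable.integral_prod_left (f := fun x t => H x t) hH.stronglyMeasurable
    exact this.measurable
  have hKb : ∀ t, |K t| ≤ M * m := fun t => by
    have := norm_integral_le_of_norm_le_const (μ := ν) (f := fun x => H x t) (C := M)
      (Eventually.of_forall fun x => habs x t)
    simpa using this
  have iu2 : Integrable (fun t => u t ^ 2) μ :=
    Integrable.of_bound (by fun_prop) (Mu ^ 2) (Eventually.of_forall fun t => by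
      rw [Real.norm_eq_abs, abs_pow]; gcongr; exact hMu t)
  have iK2 : Integrable (fun t => K t ^ 2) μ :=
    Integrable.of_bound (by fun_prop) ((M * m) ^ 2) (Eventually.of_forall fun t => by
      rw [Real.norm_eq_abs, abs_pow]; gcongr; exact hKb t)
  have iuK : Integrable (fun t => K t * u t) μ :=
    Integrable.of_bound (by fun_prop) ((M * m) * Mu) (Eventually.of_forall fun t => by
      rw [Real.norm_eq_abs, abs_mul]; gcongr; exacts [hKb t, hMu t])
  have hH' : Measurable fun p : ℝ × ℝ => H p.1 p.2 := hH
  -- step 1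
  have iHu : Integrable (Function.uncurry fun x t => H x t * u t) (ν.prod μ) :=
    Integrable.of_bound (Measurable.aestronglyMeasurable
      (hH'.mul (hu.comp measurable_snd))) (M * Mu) (Eventually.of_forall fun p => by
      simp only [Function.uncurry]
      rw [Real.norm_eq_abs, abs_mul]; gcongr; exacts [habs _ _, hMu _])
  have s1 : l * m ≤ ∫ t, K t * u t ∂μ := by
    calc l * m = ∫ _x, l ∂ν := by simp [hm, mul_comm]
      _ ≤ ∫ x, ∫ t, H x t * u t ∂μ ∂ν :=
        integral_mono_ae (integrable_const _) iHu.integral_prod_left hl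
      _ = ∫ t, ∫ x, H x t * u t ∂ν ∂μ := integral_integral_swap iHu
      _ = _ := by simp only [hK, integral_mul_const]
  -- step 2
  have iHH : Integrable (Function.uncurry fun (t : ℝ) (p : ℝ × ℝ) => H p.1 t * H p.2 t)
      (μ.prod (ν.prod ν)) :=
    Integrable.of_bound (Measurable.aestronglyMeasurable (by
      have a1 : Measurable fun q : ℝ × ℝ × ℝ => H q.2.1 q.1 :=
        hH'.comp ((measurable_fst.comp measurable_snd).prodMk measurable_fst)
      have a2 : Measurable fun q : ℝ × ℝ × ℝ => H q.2.2 q.1 :=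
        hH'.comp ((measurable_snd.comp measurable_snd).prodMk measurable_fst)
      exact a1.mul a2)) (M * M) (Eventually.of_forall fun p => by
      simp only [Function.uncurry]
      rw [Real.norm_eq_abs, abs_mul]; gcongr <;> exact habs _ _)
  have iH : Integrable (fun p : ℝ × ℝ => H p.1 p.2) (ν.prod ν) :=
    Integrable.of_bound hH'.aestronglyMeasurable M (Eventually.of_forall fun p => habs _ _)
  have iH2 : Integrable (fun p : ℝ × ℝ => H p.2 p.1) (ν.prod ν) :=
    Integrable.of_bound (hH'.comp measurable_swap).aestronglyMeasurable M
      (Eventually.of_forall fun p => habs _ _)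
  have ihx : ∀ x, Integrable (H x) μ := fun x =>
    Integrable.of_bound (hH'.comp measurable_prodMk_left).aestronglyMeasurable M
      (Eventually.of_forall fun p => habs _ _)
  have s3 : ∫ p : ℝ × ℝ, H p.1 p.2 ∂(ν.prod ν) ≤ A * m := by
    rw [integral_prod _ iH]
    calc ∫ x, ∫ y, H x y ∂ν ∂ν ≤ ∫ _x, A ∂ν := by
          refine integral_mono iH.integral_prod_left (integrable_const _) fun x => ?_
          show ∫ y, H x y ∂ν ≤ A
          rw [← hA x]
          exact integral_mono_measure hνμ (Eventually.of_forall (h0 x)) (ihx x)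
      _ = A * m := by simp [hm, mul_comm]
  have s3' : ∫ p : ℝ × ℝ, H p.2 p.1 ∂(ν.prod ν) = ∫ p : ℝ × ℝ, H p.1 p.2 ∂(ν.prod ν) :=
    integral_prod_swap (fun p : ℝ × ℝ => H p.1 p.2)
  have s2 : ∫ t, K t ^ 2 ∂μ ≤ 2 * C * A * m := by
    calc ∫ t, K t ^ 2 ∂μ = ∫ t, ∫ p : ℝ × ℝ, H p.1 t * H p.2 t ∂(ν.prod ν) ∂μ := by
          congr 1; ext t
          rw [integral_prod_mul (fun x => H x t) (fun x => H x t), sq]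
      _ = ∫ p : ℝ × ℝ, ∫ t, H p.1 t * H p.2 t ∂μ ∂(ν.prod ν) := integral_integral_swap iHH
      _ ≤ ∫ p : ℝ × ℝ, C * (H p.1 p.2 + H p.2 p.1) ∂(ν.prod ν) :=
          integral_mono iHH.integral_prod_right ((iH.add iH2).const_mul _) fun p => hC _ _
      _ ≤ 2 * C * A * m := by
          rw [integral_const_mul, integral_add iH iH2, s3']
          nlinarith
  -- combine
  have hd : 0 < 2 * C * A / l := by positivity
  set d := 2 * C * A / l with hdd
  have s4 : ∫ t, K t * u t ∂μ ≤ d / 2 * (∫ t, u t ^ 2 ∂μ) + 1 / (2 * d) * ∫ t, K t ^ 2 ∂μ := by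
    rw [← integral_const_mul, ← integral_const_mul,
      ← integral_add (iu2.const_mul _) (iK2.const_mul _)]
    refine integral_mono iuK ((iu2.const_mul _).add (iK2.const_mul _)) fun t => ?_
    show K t * u t ≤ d / 2 * u t ^ 2 + 1 / (2 * d) * K t ^ 2
    have : d / 2 * u t ^ 2 + 1 / (2 * d) * K t ^ 2 - K t * u t
        = (d * u t - K t) ^ 2 / (2 * d) := by field_simp; ring
    have : 0 ≤ (d * u t - K t) ^ 2 / (2 * d) := by positivity
    linarith
  have s5 : 1 / (2 * d) * ∫ t, K t ^ 2 ∂μ ≤ l * m / 2 := by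
    calc _ ≤ 1 / (2 * d) * (2 * C * A * m) := by gcongr
      _ = l * m / 2 := by rw [hdd]; field_simp
  have s6 : l * m ≤ d * ∫ t, u t ^ 2 ∂μ := by linarith
  have : 2 * C * A / l ^ 2 * ∫ t, u t ^ 2 ∂μ = (d * ∫ t, u t ^ 2 ∂μ) / l := by
    rw [hdd]; field_simp
  rw [this, le_div_iff₀ hl0]; linarith

lemma circlePt_norm (r θ : ℝ) (hr : 0 ≤ r) : ‖circlePt r θ‖ = r := by
  simp [circlePt, abs_of_nonneg hr, Complex.norm_exp_ofReal_mul_I]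

lemma circlePt_one_norm (θ : ℝ) : ‖circlePt 1 θ‖ = 1 := circlePt_norm 1 θ zero_le_one

lemma circlePt_eq (r θ : ℝ) : circlePt r θ = r * circlePt 1 θ := by simp [circlePt]

/-- averaging over the circle -/
lemma avg_eq {E : Type*} [NormedAddCommGroup E] [NormedSpace ℝ E] (f : ℂ → E) :
    Real.circleAverage f 0 1 = (2 * π)⁻¹ • ∫ t in Ioc 0 (2 * π), f (circlePt 1 t) := by
  rw [Real.circleAverage_def, intervalIntegral.integral_of_le Real.two_pi_pos.le]
  simp [circleMap, circlePt]

lemma pk_nonneg_s6 {w z : ℂ} (hw : ‖w‖ < 1) (hz : ‖z‖ = 1) : 0 ≤ poissonKernel 0 w z := by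
  rw [poissonKernel_def]
  simp only [sub_zero, hz]
  have := norm_nonneg w
  apply div_nonneg _ (by positivity)
  nlinarith

lemma pk_le {w z : ℂ} {ρ : ℝ} (hρ : ρ < 1) (hw : ‖w‖ ≤ ρ) (hz : ‖z‖ = 1) :
    poissonKernel 0 w z ≤ 1 / (1 - ρ) ^ 2 := by
  rw [poissonKernel_def]
  simp only [sub_zero, hz]
  have h1 : 1 - ρ ≤ ‖z - w‖ := by
    have := norm_sub_norm_le z w
    linarith
  have h2 : 0 < 1 - ρ := by linarith
  gcongr
  have := sq_nonneg ‖w‖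
  linarith

lemma dcc_int {f : ℂ → ℂ} (hf : DiffContOnCl ℂ f (Metric.ball 0 1)) {w : ℂ} (hw : ‖w‖ < 1) :
    ∫ t in Ioc 0 (2 * π), poissonKernel 0 w (circlePt 1 t) * (f (circlePt 1 t)).re
      = 2 * π * (f w).re := by
  have h := hf.circleAverage_poissonKernel_smul (w := w) (by simpa using hw)
  rw [avg_eq] at h
  have hc : Continuous fun t => circlePt 1 t := by unfold circlePt; fun_prop
  have hcf : Continuous fun t => f (circlePt 1 t) := by
    have := hf.continuousOn
    rw [closure_ball _ one_ne_zero] at this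
    refine this.comp_continuous hc fun t => ?_
    simp [circlePt_one_norm]
  have hcp : Continuous fun t => poissonKernel 0 w (circlePt 1 t) := by
    simp only [poissonKernel_def, sub_zero]
    refine Continuous.div (by fun_prop) (by fun_prop) fun t => ?_
    have : circlePt 1 t ≠ w := fun h => by
      have := circlePt_one_norm t
      rw [h] at this; linarith
    simpa [sub_eq_zero] using this
  have hi : Integrable (fun t => (poissonKernel 0 w • f) (circlePt 1 t))
      (volume.restrict (Ioc 0 (2 * π))) := by
    have : Continuous fun t => (poissonKernel 0 w • f) (circlePt 1 t) := hcp.smul hcf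
    exact this.integrableOn_Ioc
  have h2 := congrArg Complex.re h
  rw [Complex.smul_re] at h2
  have h3 := integral_re (𝕜 := ℂ) hi
  simp only [RCLike.re_eq_complex_re] at h3
  rw [← h3] at h2
  rw [← h2]
  simp
  field_simp

/-- semigroup property -/
lemma pk_semi {w v : ℂ} (hw : ‖w‖ < 1) (hv : ‖v‖ < 1) :
    ∫ t in Ioc 0 (2 * π), poissonKernel 0 w (circlePt 1 t) * poissonKernel 0 v (circlePt 1 t)
      = 2 * π * ((1 - ‖v‖ ^ 2 * ‖w‖ ^ 2) / ‖1 - (starRingEnd ℂ) v * w‖ ^ 2) := by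
  have key : ∀ x : ℂ, ((1 + x) / (1 - x)).re = (1 - ‖x‖ ^ 2) / ‖1 - x‖ ^ 2 := fun x => by
    have := congrFun (poissonKernel_eq_re_herglotzRieszKernel (c := 0) (w := x)) 1
    simpa [poissonKernel_def, herglotzRieszKernel_def] using this.symm
  have hne : ∀ z : ℂ, ‖z‖ ≤ 1 → 1 - (starRingEnd ℂ) v * z ≠ 0 := fun z hz h => by
    have : ‖(starRingEnd ℂ) v * z‖ = 1 := by rw [← sub_eq_zero.1 h]; simp
    rw [norm_mul, RCLike.norm_conj] at this
    nlinarith [norm_nonneg v, norm_nonneg z]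
  have hf : DiffContOnCl ℂ (fun z => (1 + (starRingEnd ℂ) v * z) / (1 - (starRingEnd ℂ) v * z))
      (Metric.ball 0 1) := by
    apply DifferentiableOn.diffContOnCl
    rw [closure_ball _ one_ne_zero]
    intro z hz
    have := hne z (by simpa using hz)
    exact DifferentiableAt.differentiableWithinAt (by fun_prop (disch := assumption))
  have h := dcc_int hf hw
  simp only [key, norm_mul, RCLike.norm_conj, mul_pow] at h
  rw [← h]
  congr 1; ext t
  congr 1
  simp only [poissonKernel_def, circlePt_one_norm, sub_zero]
  have : ‖circlePt 1 t - v‖ = ‖1 - (starRingEnd ℂ) v * circlePt 1 t‖ := by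
    have h1 : (starRingEnd ℂ) (circlePt 1 t) * circlePt 1 t = 1 := by
      rw [Complex.conj_mul', circlePt_one_norm]; simp
    calc ‖circlePt 1 t - v‖ = ‖(starRingEnd ℂ) (circlePt 1 t - v) * circlePt 1 t‖ := by
          rw [norm_mul, RCLike.norm_conj, circlePt_one_norm, mul_one]
      _ = _ := by rw [map_sub, sub_mul, h1]
  rw [this]; simp

lemma pk_comp_aux {w ζ : ℂ} {s : ℝ} (hζ : ‖ζ‖ = 1) (hs0 : ‖w‖ ≤ s) (hs : s < 1) :
    (1 - s ^ 2 * ‖w‖ ^ 2) / ‖1 - (starRingEnd ℂ) (s * ζ) * w‖ ^ 2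
      ≤ 8 * poissonKernel 0 w ζ := by
  have hw0 := norm_nonneg w
  have hs1 : 0 ≤ s := hw0.trans hs0
  set D := ‖1 - (starRingEnd ℂ) (s * ζ) * w‖ with hD
  have hn : ‖(starRingEnd ℂ) (s * ζ) * w‖ = s * ‖w‖ := by
    rw [norm_mul, RCLike.norm_conj, norm_mul, hζ, Complex.norm_real, Real.norm_of_nonneg hs1,
      mul_one]
  have hD1 : 1 - s * ‖w‖ ≤ D := by
    have := norm_sub_norm_le (1 : ℂ) ((starRingEnd ℂ) (s * ζ) * w)
    rw [hn, norm_one] at this; exact this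
  have hDpos : 0 < D := by nlinarith
  have h1 : (starRingEnd ℂ) ζ * ζ = 1 := by
    rw [Complex.conj_mul', hζ]; simp
  have hz : ‖ζ - w‖ ≤ 2 * D := by
    calc ‖ζ - w‖ = ‖(starRingEnd ℂ) ζ * (ζ - w)‖ := by
          rw [norm_mul, RCLike.norm_conj, hζ, one_mul]
      _ = ‖(1 - (starRingEnd ℂ) (s * ζ) * w) - ((1 - s : ℝ) : ℂ) * ((starRingEnd ℂ) ζ * w)‖ := by
          congr 1
          rw [mul_sub, h1, map_mul, Complex.conj_ofReal]; push_cast; ring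
      _ ≤ D + (1 - s) * ‖w‖ := by
          refine (norm_sub_le _ _).trans ?_
          rw [norm_mul, norm_mul, RCLike.norm_conj, hζ, one_mul, Complex.norm_real,
            Real.norm_of_nonneg (by linarith)]
      _ ≤ 2 * D := by nlinarith
  have hzpos : 0 < ‖ζ - w‖ := by
    have := norm_sub_norm_le ζ w
    rw [hζ] at this; linarith
  rw [poissonKernel_def]
  simp only [sub_zero, hζ]
  rw [← mul_div_assoc, div_le_div_iff₀ (by positivity) (by positivity)]
  have a1 : 1 - s ^ 2 * ‖w‖ ^ 2 ≤ 2 * (1 - ‖w‖ ^ 2) := by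
    have : ‖w‖ ^ 2 ≤ s ^ 2 := by gcongr
    have h3 : ‖w‖ ^ 2 ≤ 1 := by nlinarith
    nlinarith [sq_nonneg (1 - ‖w‖ ^ 2), sq_nonneg ‖w‖]
  have a2 : ‖ζ - w‖ ^ 2 ≤ 4 * D ^ 2 := by nlinarith
  have a3 : 0 ≤ 1 - ‖w‖ ^ 2 := by nlinarith
  calc (1 - s ^ 2 * ‖w‖ ^ 2) * ‖ζ - w‖ ^ 2 ≤ (2 * (1 - ‖w‖ ^ 2)) * (4 * D ^ 2) := by gcongr
    _ = _ := by ring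

lemma pk_comp {r s θ φ : ℝ} (hr0 : 0 ≤ r) (hr : r < 1) (hs0 : 0 ≤ s) (hs : s < 1) :
    (1 - ‖circlePt s φ‖ ^ 2 * ‖circlePt r θ‖ ^ 2)
        / ‖1 - (starRingEnd ℂ) (circlePt s φ) * circlePt r θ‖ ^ 2
      ≤ 8 * (poissonKernel 0 (circlePt r θ) (circlePt 1 φ) +
        poissonKernel 0 (circlePt s φ) (circlePt 1 θ)) := by
  have p1 : 0 ≤ poissonKernel 0 (circlePt r θ) (circlePt 1 φ) :=
    pk_nonneg_s6 (by rwa [circlePt_norm r θ hr0]) (circlePt_one_norm _)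
  have p2 : 0 ≤ poissonKernel 0 (circlePt s φ) (circlePt 1 θ) :=
    pk_nonneg_s6 (by rwa [circlePt_norm s φ hs0]) (circlePt_one_norm _)
  rcases le_total r s with h | h
  · have := pk_comp_aux (w := circlePt r θ) (circlePt_one_norm φ) (s := s)
      (by rwa [circlePt_norm r θ hr0]) hs
    rw [← circlePt_eq] at this
    rw [circlePt_norm s φ hs0]
    linarith
  · have := pk_comp_aux (w := circlePt s φ) (circlePt_one_norm θ) (s := r)
      (by rwa [circlePt_norm s φ hs0]) hr
    rw [← circlePt_eq] at this
    rw [circlePt_norm r θ hr0]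
    have e : ‖1 - (starRingEnd ℂ) (circlePt s φ) * circlePt r θ‖ =
        ‖1 - (starRingEnd ℂ) (circlePt r θ) * circlePt s φ‖ := by
      rw [← RCLike.norm_conj]; simp [mul_comm]
    rw [e, mul_comm (‖circlePt s φ‖ ^ 2)]
    linarith

/-- core weak type inequality -/
lemma weak_core {f : ℂ → ℂ} (hf : DiffContOnCl ℂ f (Metric.ball 0 1)) (r : ℝ → ℝ)
    (hr : Measurable r) (hr0 : ∀ θ, 0 ≤ r θ) (ρ : ℝ) (hρ : ρ < 1) (hrρ : ∀ θ, r θ ≤ ρ)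
    (S : Set ℝ) (hS : MeasurableSet S) (l : ℝ) (hl : 0 < l)
    (hSl : ∀ θ ∈ S, l ≤ (f (circlePt (r θ) θ)).re) :
    (volume (S ∩ Ioc 0 (2 * π))).toReal ≤
      16 / l ^ 2 * ∫ t in Ioc 0 (2 * π), (f (circlePt 1 t)).re ^ 2 := by
  have hrl : ∀ θ, ‖circlePt (r θ) θ‖ < 1 := fun θ => by
    rw [circlePt_norm _ _ (hr0 θ)]; exact (hrρ θ).trans_lt hρ
  have hc : Continuous fun t => circlePt 1 t := by unfold circlePt; fun_prop
  have hcf : Continuous fun t => f (circlePt 1 t) := by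
    have := hf.continuousOn
    rw [closure_ball _ one_ne_zero] at this
    refine this.comp_continuous hc fun t => ?_
    simp [circlePt_one_norm]
  obtain ⟨Mu, hMu⟩ : ∃ Mu, ∀ t, |(f (circlePt 1 t)).re| ≤ Mu := by
    have := hf.continuousOn
    rw [closure_ball _ one_ne_zero] at this
    obtain ⟨B, hB⟩ := (isCompact_closedBall (0 : ℂ) 1).exists_bound_of_continuousOn this
    exact ⟨B, fun t => (Complex.abs_re_le_norm _).trans (hB _ (by simp [circlePt_one_norm]))⟩
  have := abs_max (μ := volume.restrict (Ioc 0 (2 * π)))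
    (ν := (volume.restrict (Ioc 0 (2 * π))).restrict S) Measure.restrict_le_self
    (fun θ t => poissonKernel 0 (circlePt (r θ) θ) (circlePt 1 t))
    (by
      simp only [poissonKernel_def, circlePt, Function.uncurry_def]
      fun_prop)
    (fun θ t => pk_nonneg_s6 (hrl θ) (circlePt_one_norm t)) (1 / (1 - ρ) ^ 2)
    (fun θ t => pk_le hρ (by rw [circlePt_norm _ _ (hr0 θ)]; exact hrρ θ) (circlePt_one_norm t))
    (2 * π) (2 * π * 8) (by positivity) (by positivity)
    (fun θ => by
      have := dcc_int (f := fun _ => 1) diffContOnCl_const (hrl θ)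
      simpa using this)
    (fun θ φ => by
      rw [pk_semi (hrl θ) (hrl φ), mul_assoc (2 * π) 8]
      exact mul_le_mul_of_nonneg_left
        (pk_comp (hr0 θ) ((hrρ θ).trans_lt hρ) (hr0 φ) ((hrρ φ).trans_lt hρ)) (by positivity))
    (fun t => (f (circlePt 1 t)).re)
    (Complex.measurable_re.comp hcf.measurable) Mu hMu (2 * π * l) (by positivity)
    (by
      refine (ae_restrict_iff' hS).2 (Eventually.of_forall fun θ hθ => ?_)
      rw [dcc_int hf (hrl θ)]
      gcongr
      exact hSl θ hθ)
  rw [measureReal_restrict_apply_univ, measureReal_restrict_apply hS] at this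
  refine this.trans ?_
  have hI : 0 ≤ ∫ t in Ioc 0 (2 * π), (f (circlePt 1 t)).re ^ 2 :=
    integral_nonneg fun _ => sq_nonneg _
  have e : 2 * (2 * π * 8) * (2 * π) / (2 * π * l) ^ 2 = 16 / l ^ 2 := by
    field_simp; ring
  rw [e]

lemma circlePt_mem {r θ : ℝ} (h0 : 0 ≤ r) (h1 : r < 1) : circlePt r θ ∈ unitDisk := by
  simp [unitDisk, circlePt_norm r θ h0, h1]

/-- measurable selection from finitely many radii -/
lemma select (h : ℂ → ℝ) (hh : ContinuousOn h unitDisk) (l : ℝ) (q : ℕ → ℝ)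
    (hq0 : ∀ i, 0 ≤ q i) (hq1 : ∀ i, q i < 1) (N : ℕ) :
    ∃ (r : ℝ → ℝ) (ρ : ℝ), Measurable r ∧ (∀ θ, 0 ≤ r θ) ∧ 0 ≤ ρ ∧ ρ < 1 ∧ (∀ θ, r θ ≤ ρ) ∧
      (∀ θ, (∃ i < N, l < h (circlePt (q i) θ)) → l < h (circlePt (r θ) θ)) := by
  classical
  induction N with
  | zero => exact ⟨fun _ => 0, 0, measurable_const, by simp, le_rfl, zero_lt_one, by simp, by simp⟩
  | succ N ih =>
    obtain ⟨r, ρ, hr, h0, hρ0, hρ, hrρ, hs⟩ := ih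
    have hms : MeasurableSet {θ : ℝ | l < h (circlePt (q N) θ)} := by
      have : Continuous fun θ => h (circlePt (q N) θ) :=
        hh.comp_continuous (by unfold circlePt; fun_prop) fun θ => circlePt_mem (hq0 N) (hq1 N)
      exact (isOpen_lt continuous_const this).measurableSet
    refine ⟨fun θ => if l < h (circlePt (q N) θ) then q N else r θ, max ρ (q N),
      Measurable.ite hms measurable_const hr, fun θ => ?_, le_max_of_le_left hρ0,
      max_lt hρ (hq1 N), fun θ => ?_, ?_⟩
    · dsimp only; split_ifs
      exacts [hq0 N, h0 θ]
    · dsimp only; split_ifs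
      exacts [le_max_right _ _, le_max_of_le_left (hrρ θ)]
    · rintro θ ⟨i, hi, hli⟩
      dsimp only
      split_ifs with hc
      · exact hc
      · refine hs θ ⟨i, ?_, hli⟩
        rcases Nat.lt_succ_iff_lt_or_eq.1 hi with h | rfl
        · exact h
        · exact absurd hli hc

lemma mean_sq {g : ℂ → ℂ} (hg : DifferentiableOn ℂ g unitDisk) (hb : ∀ z ∈ unitDisk, ‖g z‖ ≤ 1)
    (ω : ℂ) (hω : ‖ω‖ = 1) (R : ℝ) (hR0 : 0 < R) (hR : R < 1) :
    ∫ t in Ioc 0 (2 * π), (ω * (g (R * circlePt 1 t) - 1)).re ^ 2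
      ≤ 4 * π * (1 - (g 0).re) := by
  have hmem : ∀ z : ℂ, ‖z‖ ≤ 1 → (R : ℂ) * z ∈ unitDisk := fun z hz => by
    simp only [unitDisk, mem_ball_zero_iff, norm_mul, Complex.norm_real, Real.norm_of_nonneg hR0.le]
    nlinarith [norm_nonneg z]
  have hf : DiffContOnCl ℂ (fun z => 1 - g (R * z)) (Metric.ball 0 1) := by
    apply DifferentiableOn.diffContOnCl
    rw [closure_ball _ one_ne_zero]
    refine (differentiableOn_const _).sub (hg.comp (by fun_prop) fun z hz => hmem z (by simpa using hz))
  have h := dcc_int hf (w := 0) (by simp)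
  simp [poissonKernel_def, circlePt_one_norm] at h
  have hcg : Continuous fun t : ℝ => g (R * circlePt 1 t) :=
    hg.continuousOn.comp_continuous (by unfold circlePt; fun_prop)
      fun t => hmem _ (circlePt_one_norm t).le
  calc _ ≤ ∫ t in Ioc 0 (2 * π), 2 * (1 - (g (R * circlePt 1 t)).re) := by
        refine integral_mono (Continuous.integrableOn_Ioc ?_) (Continuous.integrableOn_Ioc ?_) ?_
        · exact (Complex.continuous_re.comp (continuous_const.mul (hcg.sub continuous_const))).pow 2
        · exact continuous_const.mul (continuous_const.sub (Complex.continuous_re.comp hcg))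
        · intro t
          dsimp only
          set x := g (R * circlePt 1 t)
          have hx : ‖x‖ ≤ 1 := hb _ (hmem _ (circlePt_one_norm t).le)
          have h1 : |(ω * (x - 1)).re| ≤ ‖x - 1‖ := by
            refine (Complex.abs_re_le_norm _).trans ?_
            rw [norm_mul, hω, one_mul]
          have h2 : (ω * (x - 1)).re ^ 2 ≤ ‖x - 1‖ ^ 2 := by
            rw [← sq_abs]; gcongr
          have h3 : ‖x - 1‖ ^ 2 = ‖x‖ ^ 2 - 2 * x.re + 1 := by
            rw [Complex.sq_norm, Complex.sq_norm, Complex.normSq_apply, Complex.normSq_apply]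
            simp; ring
          nlinarith [norm_nonneg x]
    _ = 4 * π * (1 - (g 0).re) := by rw [integral_const_mul, h]; ring

lemma weak_re {g : ℂ → ℂ} (hg : DifferentiableOn ℂ g unitDisk) (hb : ∀ z ∈ unitDisk, ‖g z‖ ≤ 1)
    (ω : ℂ) (hω : ‖ω‖ = 1) (l : ℝ) (hl : 0 < l) :
    volume ({θ | ∃ r ∈ Ico (0 : ℝ) 1, l < (ω * (g (circlePt r θ) - 1)).re} ∩ Ioc 0 (2 * π)) ≤
      ENNReal.ofReal (64 * π / l ^ 2 * (1 - (g 0).re)) := by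
  have : Nonempty (Ico (0 : ℝ) 1) := ⟨⟨0, by simp⟩⟩
  set q : ℕ → ℝ := fun i => (TopologicalSpace.denseSeq (Ico (0 : ℝ) 1) i : ℝ) with hq
  have hq0 : ∀ i, 0 ≤ q i := fun i => (TopologicalSpace.denseSeq (Ico (0 : ℝ) 1) i).2.1
  have hq1 : ∀ i, q i < 1 := fun i => (TopologicalSpace.denseSeq (Ico (0 : ℝ) 1) i).2.2
  set h : ℂ → ℝ := fun z => (ω * (g z - 1)).re with hh
  have hhc : ContinuousOn h unitDisk :=
    Complex.continuous_re.comp_continuousOn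
      (continuousOn_const.mul (hg.continuousOn.sub continuousOn_const))
  set E : ℕ → Set ℝ := fun N => {θ | ∃ i < N, l < h (circlePt (q i) θ)} ∩ Ioc 0 (2 * π) with hE
  have hsub : {θ | ∃ r ∈ Ico (0 : ℝ) 1, l < (ω * (g (circlePt r θ) - 1)).re} ∩ Ioc 0 (2 * π) ⊆
      ⋃ N, E N := by
    rintro θ ⟨⟨r, hr, hlr⟩, hθ⟩
    have hc : Continuous fun r : Ico (0 : ℝ) 1 => h (circlePt r θ) :=
      hhc.comp_continuous (by unfold circlePt; fun_prop) fun r => circlePt_mem r.2.1 r.2.2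
    obtain ⟨i, hi⟩ := (TopologicalSpace.denseRange_denseSeq (Ico (0 : ℝ) 1)).exists_mem_open
      (isOpen_lt continuous_const hc) ⟨⟨r, hr⟩, hlr⟩
    exact mem_iUnion.2 ⟨i + 1, ⟨i, by simp, hi⟩, hθ⟩
  have hmono : Monotone E := by
    rintro a b hab θ ⟨⟨i, hi, hl⟩, hθ⟩
    exact ⟨⟨i, hi.trans_le hab, hl⟩, hθ⟩
  refine (measure_mono hsub).trans ?_
  rw [hmono.measure_iUnion]
  refine iSup_le fun N => ?_
  obtain ⟨r, ρ, hr, h0, hρ0, hρ, hrρ, hs⟩ := select h hhc l q hq0 hq1 N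
  set R := (1 + ρ) / 2 with hR
  have hR0 : 0 < R := by rw [hR]; linarith
  have hR1 : R < 1 := by rw [hR]; linarith
  have hρR : ρ / R < 1 := by rw [div_lt_one hR0, hR]; linarith
  have hmem : ∀ z : ℂ, ‖z‖ ≤ 1 → (R : ℂ) * z ∈ unitDisk := fun z hz => by
    simp only [unitDisk, mem_ball_zero_iff, norm_mul, Complex.norm_real, Real.norm_of_nonneg hR0.le]
    nlinarith [norm_nonneg z]
  have hf : DiffContOnCl ℂ (fun z => ω * (g (R * z) - 1)) (Metric.ball 0 1) := by
    apply DifferentiableOn.diffContOnCl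
    rw [closure_ball _ one_ne_zero]
    refine (differentiableOn_const _).mul ((hg.comp (by fun_prop)
      fun z hz => hmem z (by simpa using hz)).sub (differentiableOn_const _))
  have hms : MeasurableSet {θ | ∃ i < N, l < h (circlePt (q i) θ)} := by
    have : ∀ i, IsOpen {θ : ℝ | l < h (circlePt (q i) θ)} := fun i => by
      have : Continuous fun θ => h (circlePt (q i) θ) :=
        hhc.comp_continuous (by unfold circlePt; fun_prop) fun θ => circlePt_mem (hq0 i) (hq1 i)
      exact isOpen_lt continuous_const this
    have e : {θ | ∃ i < N, l < h (circlePt (q i) θ)} =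
        ⋃ i, ⋃ _ : i < N, {θ : ℝ | l < h (circlePt (q i) θ)} := by
      ext; simp
    rw [e]
    exact (isOpen_iUnion fun i => isOpen_iUnion fun _ => this i).measurableSet
  have key := weak_core hf (fun θ => r θ / R) (hr.div_const _) (fun θ => div_nonneg (h0 θ) hR0.le)
    (ρ / R) hρR (fun θ => by gcongr; exact hrρ θ) _ hms l hl (fun θ hθ => by
      have := hs θ hθ
      have e : (R : ℂ) * circlePt (r θ / R) θ = circlePt (r θ) θ := by
        have : (R : ℂ) ≠ 0 := by exact_mod_cast hR0.ne'
        simp only [circlePt]; push_cast; field_simp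
      rw [e]; exact this.le)
  have hfin : volume (E N) ≠ ∞ :=
    ((measure_mono inter_subset_right).trans_lt (by
      rw [Real.volume_Ioc]; exact ENNReal.ofReal_lt_top)).ne
  rw [← ENNReal.ofReal_toReal hfin]
  apply ENNReal.ofReal_le_ofReal
  refine key.trans ?_
  calc _ ≤ 16 / l ^ 2 * (4 * π * (1 - (g 0).re)) := by
        gcongr
        exact mean_sq hg hb ω hω R hR0 hR1
    _ = _ := by ring

lemma weak_norm {g : ℂ → ℂ} (hg : DifferentiableOn ℂ g unitDisk) (hb : ∀ z ∈ unitDisk, ‖g z‖ ≤ 1)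
    (l : ℝ) (hl : 0 < l) :
    volume ({θ | ∃ r ∈ Ico (0 : ℝ) 1, 2 * l < ‖g (circlePt r θ) - 1‖} ∩ Ioc 0 (2 * π)) ≤
      4 * ENNReal.ofReal (64 * π / l ^ 2 * (1 - (g 0).re)) := by
  have h1 := weak_re hg hb 1 (by simp) l hl
  have h2 := weak_re hg hb (-1) (by simp) l hl
  have h3 := weak_re hg hb Complex.I (by simp) l hl
  have h4 := weak_re hg hb (-Complex.I) (by simp) l hl
  refine (measure_mono (t := ((_ ∪ _) ∪ (_ ∪ _))) ?_).trans ((measure_union_le _ _).trans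
    ((add_le_add ((measure_union_le _ _).trans (add_le_add h1 h2))
      ((measure_union_le _ _).trans (add_le_add h3 h4))).trans_eq (by ring)))
  rintro θ ⟨⟨r, hr, h⟩, hθ⟩
  set x := g (circlePt r θ) - 1 with hx
  have hh : 2 * l < |x.re| + |x.im| := h.trans_le (Complex.norm_le_abs_re_add_abs_im x)
  have : l < x.re ∨ l < -x.re ∨ l < x.im ∨ l < -x.im := by
    by_contra hcon
    push Not at hcon
    obtain ⟨a, b, c, d⟩ := hcon
    have := abs_le'.2 ⟨a, b⟩
    have := abs_le'.2 ⟨c, d⟩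
    linarith
  rcases this with h | h | h | h
  · exact Or.inl (Or.inl ⟨⟨r, hr, by rw [← hx]; simpa using h⟩, hθ⟩)
  · exact Or.inl (Or.inr ⟨⟨r, hr, by rw [← hx]; simpa using h⟩, hθ⟩)
  · exact Or.inr (Or.inr ⟨⟨r, hr, by rw [← hx]; simpa using h⟩, hθ⟩)
  · exact Or.inr (Or.inl ⟨⟨r, hr, by rw [← hx]; simpa using h⟩, hθ⟩)

lemma bl_den {a z : ℂ} (ha : ‖a‖ < 1) (_hz : ‖z‖ < 1) : 1 - ‖z‖ ≤ ‖1 - (starRingEnd ℂ) a * z‖ := by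
  have := norm_sub_norm_le (1 : ℂ) ((starRingEnd ℂ) a * z)
  rw [norm_mul, RCLike.norm_conj, norm_one] at this
  nlinarith [norm_nonneg z, norm_nonneg a]

lemma bl_den_ne {a z : ℂ} (ha : ‖a‖ < 1) (hz : ‖z‖ < 1) : 1 - (starRingEnd ℂ) a * z ≠ 0 := by
  have := bl_den ha hz
  exact norm_pos_iff.1 (by linarith)

lemma bl_norm_le {a z : ℂ} (ha : ‖a‖ < 1) (ha0 : a ≠ 0) (hz : ‖z‖ < 1) :
    ‖blaschkeFactor a z‖ ≤ 1 := by
  have h1 : ‖(‖a‖ : ℂ) / a‖ = 1 := by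
    rw [norm_div, Complex.norm_real, norm_norm, div_self (norm_ne_zero_iff.2 ha0)]
  have hd := norm_pos_iff.2 (bl_den_ne ha hz)
  rw [blaschkeFactor, norm_mul, h1, one_mul, norm_div, div_le_one hd]
  refine (sq_le_sq₀ (norm_nonneg _) hd.le).1 ?_
  have e : ‖1 - (starRingEnd ℂ) a * z‖ ^ 2 - ‖a - z‖ ^ 2 = (1 - ‖a‖ ^ 2) * (1 - ‖z‖ ^ 2) := by
    simp only [Complex.sq_norm, Complex.normSq_apply]
    simp; ring
  have : 0 ≤ (1 - ‖a‖ ^ 2) * (1 - ‖z‖ ^ 2) := by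
    apply mul_nonneg <;> nlinarith [norm_nonneg a, norm_nonneg z]
  linarith

lemma bl_sub_le {a z : ℂ} (ha : ‖a‖ < 1) (ha0 : a ≠ 0) (hz : ‖z‖ < 1) :
    ‖blaschkeFactor a z - 1‖ ≤ 2 / (1 - ‖z‖) * (1 - ‖a‖) := by
  have hd := bl_den_ne ha hz
  have e : blaschkeFactor a z - 1 =
      -(((1 - ‖a‖ : ℝ) : ℂ) * ((1 + ‖a‖ / a * z) / (1 - (starRingEnd ℂ) a * z))) := by
    have h : (starRingEnd ℂ) a * a = (‖a‖ : ℂ) ^ 2 := Complex.conj_mul' a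
    rw [blaschkeFactor]
    push_cast
    generalize hD : 1 - (starRingEnd ℂ) a * z = D at hd ⊢
    field_simp
    rw [← hD]
    linear_combination z * h
  have h1 : ‖(‖a‖ : ℂ) / a‖ = 1 := by
    rw [norm_div, Complex.norm_real, norm_norm, div_self (norm_ne_zero_iff.2 ha0)]
  rw [e, norm_neg, norm_mul, Complex.norm_real, Real.norm_of_nonneg (by linarith), norm_div,
    mul_comm]
  have h2 : ‖1 + (‖a‖ : ℂ) / a * z‖ ≤ 2 := by
    refine (norm_add_le _ _).trans ?_
    rw [norm_mul, h1, norm_one]; linarith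
  have h3 : 0 < 1 - ‖z‖ := by linarith
  have h4 : 0 ≤ 1 - ‖a‖ := by linarith
  gcongr
  exact bl_den ha hz

lemma bl_zero {a : ℂ} (ha0 : a ≠ 0) : blaschkeFactor a 0 = (‖a‖ : ℂ) := by
  simp [blaschkeFactor, ha0]

lemma bl_props (a : ℕ → ℂ) (ha : ∀ k, a k ∈ unitDisk ∧ a k ≠ 0)
    (hsum : Summable fun k => 1 - ‖a k‖) :
    DifferentiableOn ℂ (fun z => ∏' k, blaschkeFactor (a k) z) unitDisk ∧
    (∀ z ∈ unitDisk, ‖∏' k, blaschkeFactor (a k) z‖ ≤ 1) ∧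
    1 - (∏' k, blaschkeFactor (a k) 0).re ≤ ∑' k, (1 - ‖a k‖) := by
  have ha1 : ∀ k, ‖a k‖ < 1 := fun k => by simpa [unitDisk] using (ha k).1
  have hdiff : ∀ k, DifferentiableOn ℂ (blaschkeFactor (a k)) unitDisk := fun k z hz => by
    have := bl_den_ne (ha1 k) (z := z) (by simpa [unitDisk] using hz)
    unfold blaschkeFactor
    exact DifferentiableAt.differentiableWithinAt (by fun_prop (disch := assumption))
  have hloc : ∀ R < 1, HasProdLocallyUniformlyOn (fun k z => blaschkeFactor (a k) z)
      (fun z => ∏' k, blaschkeFactor (a k) z) (Metric.ball (0 : ℂ) R) := fun R hR => by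
    have := Summable.hasProdLocallyUniformlyOn_nat_one_add
      (f := fun k z => blaschkeFactor (a k) z - 1) (Metric.isOpen_ball (x := (0 : ℂ)) (ε := R))
      (hsum.mul_left (2 / (1 - R))) (Eventually.of_forall fun k z hz => by
        have hz : ‖z‖ < R := by simpa using hz
        refine (bl_sub_le (ha1 k) (ha k).2 (hz.trans hR)).trans ?_
        have := ha1 k
        have : 0 < 1 - R := by linarith
        have : 0 ≤ 1 - ‖a k‖ := by linarith
        gcongr) (fun k => ((hdiff k).continuousOn.mono (Metric.ball_subset_ball hR.le)).sub
          continuousOn_const)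
    simpa using this
  have hmult : ∀ z ∈ unitDisk, HasProd (fun k => blaschkeFactor (a k) z)
      (∏' k, blaschkeFactor (a k) z) := fun z hz => by
    have hz : ‖z‖ < 1 := by simpa [unitDisk] using hz
    exact (hloc ((1 + ‖z‖) / 2) (by linarith)).hasProd (x := z) (by simp; linarith)
  refine ⟨fun z hz => ?_, fun z hz => ?_, ?_⟩
  · have hz : ‖z‖ < 1 := by simpa [unitDisk] using hz
    have hR : (1 + ‖z‖) / 2 < 1 := by linarith
    have h := (hloc _ hR).differentiableOn (.of_forall fun s => by
      have := DifferentiableOn.finsetProd (u := s) (f := fun k => blaschkeFactor (a k))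
        (fun k _ => (hdiff k).mono (Metric.ball_subset_ball hR.le))
      simpa [Finset.prod_fn] using this) Metric.isOpen_ball
    refine (h.differentiableAt (Metric.isOpen_ball.mem_nhds ?_)).differentiableWithinAt
    simp; linarith
  · refine le_of_tendsto (hmult z hz).norm (Eventually.of_forall fun s => ?_)
    exact Finset.prod_le_one (fun _ _ => norm_nonneg _)
      fun k _ => bl_norm_le (ha1 k) (ha k).2 (by simpa [unitDisk] using hz)
  · have h0 := hmult 0 (by simp [unitDisk])
    have h1 := (Complex.continuous_re.tendsto _).comp h0
    have hfin : ∀ s : Finset ℕ, 1 - ∑ k ∈ s, (1 - ‖a k‖) ≤ ∏ k ∈ s, ‖a k‖ ∧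
        ∏ k ∈ s, ‖a k‖ ≤ 1 := fun s => by
      induction s using Finset.induction_on with
      | empty => simp
      | insert k s hk ih =>
        rw [Finset.sum_insert hk, Finset.prod_insert hk]
        have := ha1 k
        have := norm_nonneg (a k)
        have : 0 ≤ ∏ k ∈ s, ‖a k‖ := Finset.prod_nonneg fun _ _ => norm_nonneg _
        constructor <;> nlinarith
    have : 1 - ∑' k, (1 - ‖a k‖) ≤ (∏' k, blaschkeFactor (a k) 0).re := by
      refine ge_of_tendsto h1 (Eventually.of_forall fun s => ?_)
      simp only [Function.comp, bl_zero (ha _).2]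
      rw [← Complex.ofReal_prod, Complex.ofReal_re]
      refine le_trans ?_ (hfin s).1
      have := hsum.sum_le_tsum s (fun k _ => by have := ha1 k; linarith)
      linarith
    linarith

lemma elog1p_le (x : ℝ≥0∞) : elog1p x ≤ x := by
  unfold elog1p
  split_ifs with h
  · rw [h]
  · refine ENNReal.ofReal_le_of_le_toReal ?_
    have h0 : 0 ≤ x.toReal := ENNReal.toReal_nonneg
    have := Real.log_le_sub_one_of_pos (x := 1 + x.toReal) (by linarith)
    linarith

lemma int_bound {g : ℂ → ℂ} (hg : DifferentiableOn ℂ g unitDisk) (hb : ∀ z ∈ unitDisk, ‖g z‖ ≤ 1)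
    (l : ℝ) (hl : 0 < l) (p : ℝ) (hp : 0 < p) :
    ∫⁻ θ in Set.Ioc 0 (2 * π), elog1p (maxRad (g - 1) θ) ^ p ≤
      ENNReal.ofReal (2 * l) ^ p * ENNReal.ofReal (2 * π) +
      2 ^ p * (4 * ENNReal.ofReal (64 * π / l ^ 2 * (1 - (g 0).re))) := by
  set S := {θ | ∃ r ∈ Ico (0 : ℝ) 1, 2 * l < ‖g (circlePt r θ) - 1‖} with hS
  have hSm : MeasurableSet S := by
    have e : S = ⋃ r, ⋃ _ : r ∈ Ico (0 : ℝ) 1, {θ | 2 * l < ‖g (circlePt r θ) - 1‖} := by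
      ext; simp [hS]
    rw [e]
    refine (isOpen_iUnion fun r => isOpen_iUnion fun hr => ?_).measurableSet
    have : Continuous fun θ => g (circlePt r θ) :=
      hg.continuousOn.comp_continuous (by unfold circlePt; fun_prop)
        fun θ => circlePt_mem hr.1 hr.2
    exact isOpen_lt continuous_const (this.sub continuous_const).norm
  have hpt : ∀ θ, elog1p (maxRad (g - 1) θ) ^ p ≤
      ENNReal.ofReal (2 * l) ^ p + S.indicator (fun _ => (2 : ℝ≥0∞) ^ p) θ := fun θ => by
    by_cases hθ : θ ∈ S
    · rw [indicator_of_mem hθ]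
      refine le_trans ?_ le_add_self
      refine ENNReal.rpow_le_rpow ((elog1p_le _).trans ?_) hp.le
      refine iSup₂_le fun r hr => ?_
      have h1 : ‖(g - 1) (circlePt r θ)‖₊ ≤ 2 := by
        have := hb _ (circlePt_mem (θ := θ) hr.1 hr.2)
        have h2 := norm_sub_le (g (circlePt r θ)) 1
        rw [norm_one] at h2
        have : ‖(g - 1) (circlePt r θ)‖ ≤ 2 := by
          show ‖g (circlePt r θ) - 1‖ ≤ 2
          linarith
        exact_mod_cast this
      exact_mod_cast h1
    · rw [indicator_of_notMem hθ, add_zero]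
      refine ENNReal.rpow_le_rpow ((elog1p_le _).trans ?_) hp.le
      refine iSup₂_le fun r hr => ?_
      have h2 : ‖g (circlePt r θ) - 1‖ ≤ 2 * l := by
        by_contra hcon
        exact hθ ⟨r, hr, not_le.1 hcon⟩
      rw [← enorm_eq_nnnorm, ← ofReal_norm]
      exact ENNReal.ofReal_le_ofReal h2
  refine (lintegral_mono hpt).trans ?_
  rw [lintegral_add_left measurable_const, lintegral_const, lintegral_indicator_const hSm,
    Measure.restrict_apply hSm, Measure.restrict_apply_univ, Real.volume_Ioc, sub_zero]
  gcongr
  exact weak_norm hg hb l hl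

/-- The tail products `g_n` of an infinite Blaschke product converge to the
constant function `1` in `(M^p, ρ_p)` for every `p > 1`. -/
theorem blaschke_tails_tendsto_one
    (a : ℕ → ℂ) (ha : ∀ k, a k ∈ unitDisk ∧ a k ≠ 0)
    (hsum : Summable fun k => 1 - ‖a k‖)
    (g : ℕ → ℂ → ℂ)
    (hg : ∀ n, ∀ z ∈ unitDisk, g n z = ∏' k, blaschkeFactor (a (n + k)) z)
    (p : ℝ) (hp : 1 < p) :
    Tendsto (fun n => rhoMetric p (g n) 1) atTop (nhds 0) := by
  have hp0 : 0 < p := by linarith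
  set σ : ℕ → ℝ := fun n => ∑' k, (1 - ‖a (n + k)‖) with hσ
  have hσ0 : Tendsto σ atTop (𝓝 0) := by
    have := tendsto_sum_nat_add fun k => 1 - ‖a k‖
    simpa only [hσ, add_comm] using this
  have hprops := fun n => bl_props (fun k => a (n + k)) (fun k => ha _) (by
    have := (summable_nat_add_iff n).2 hsum
    simpa only [add_comm] using this)
  have hd : ∀ n, DifferentiableOn ℂ (g n) unitDisk := fun n =>
    (hprops n).1.congr fun z hz => hg n z hz
  have hb : ∀ n, ∀ z ∈ unitDisk, ‖g n z‖ ≤ 1 := fun n z hz => by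
    rw [hg n z hz]; exact (hprops n).2.1 z hz
  have h0 : ∀ n, 1 - (g n 0).re ≤ σ n := fun n => by
    rw [hg n 0 (by simp [unitDisk])]; exact (hprops n).2.2
  have hI : Tendsto (fun n => ∫⁻ θ in Set.Ioc 0 (2 * π), elog1p (maxRad (g n - 1) θ) ^ p)
      atTop (𝓝 0) := by
    rw [ENNReal.tendsto_nhds_zero]
    intro ε hε
    -- choose l
    have hl : Tendsto (fun l : ℝ => ENNReal.ofReal (2 * l) ^ p * ENNReal.ofReal (2 * π))
        (𝓝[>] 0) (𝓝 0) := by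
      have h1 : Tendsto (fun l : ℝ => ENNReal.ofReal (2 * l)) (𝓝 0) (𝓝 0) := by
        have : Continuous fun l : ℝ => ENNReal.ofReal (2 * l) :=
          ENNReal.continuous_ofReal.comp (by fun_prop)
        simpa using this.tendsto 0
      have h2 := (ENNReal.continuous_rpow_const (y := p)).tendsto 0 |>.comp h1
      have h3 := ENNReal.Tendsto.mul_const (b := ENNReal.ofReal (2 * π)) h2
        (Or.inr ENNReal.ofReal_ne_top)
      rw [ENNReal.zero_rpow_of_pos hp0, zero_mul] at h3
      exact h3.mono_left nhdsWithin_le_nhds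
    have hε2 : 0 < ε / 2 := ENNReal.half_pos hε.ne'
    obtain ⟨l, hl1, hl0⟩ := ((ENNReal.tendsto_nhds_zero.1 hl _ hε2).and
      self_mem_nhdsWithin).exists
    have hl0 : 0 < l := hl0
    have hn : Tendsto (fun n => (2 : ℝ≥0∞) ^ p * (4 * ENNReal.ofReal (64 * π / l ^ 2 * σ n)))
        atTop (𝓝 0) := by
      have h1 : Tendsto (fun n => ENNReal.ofReal (64 * π / l ^ 2 * σ n)) atTop (𝓝 0) := by
        simpa using ENNReal.tendsto_ofReal (hσ0.const_mul (64 * π / l ^ 2))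
      have h2 := ENNReal.Tendsto.const_mul (a := 4) h1 (Or.inr (by simp))
      have h3 := ENNReal.Tendsto.const_mul (a := (2 : ℝ≥0∞) ^ p) h2
        (Or.inr (ENNReal.rpow_ne_top_of_nonneg hp0.le (by simp)))
      simpa using h3
    filter_upwards [ENNReal.tendsto_nhds_zero.1 hn _ hε2] with n hn
    refine (int_bound (hd n) (hb n) l hl0 p hp0).trans ?_
    rw [← ENNReal.add_halves ε]
    refine add_le_add hl1 (le_trans ?_ hn)
    gcongr
    exact h0 n
  have h1 := ENNReal.Tendsto.div_const (b := ENNReal.ofReal (2 * π)) hI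
    (Or.inr (by simp [Real.pi_pos]))
  rw [ENNReal.zero_div] at h1
  have h2 := (ENNReal.continuous_rpow_const (y := 1 / p)).tendsto 0 |>.comp h1
  rw [ENNReal.zero_rpow_of_pos (by positivity)] at h2
  exact h2
end
end
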